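/- For every n ≥ 1 and every sequence (t_k)_{k ≥ 0} in a commutative ring: Σ_{π ∈ NCL(n)} ∏_{A block of π} t_{|A|−1} = Σ_{α ∈ NC(n)} (∏_{U outer block of α} t_{|U|−1}) · (∏_{V inner block of α} (t_{|V|−1} + t_{|V|})). (Applied to the coefficients t_k of the reciprocal S-transform 1/S_a of a noncommutative random variable a with φ(a) = 1, both sides equal the moment φ(aⁿ).) -/

import Mathlib

open scoped Classical

/-- The minimum of a finset of naturals (`0` if empty). -/
noncomputable def fmin (A : Finset ℕ) : ℕ := sInf (A : Set ℕ)

/-- The maximum of a finset of naturals (`0` if empty). -/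
noncomputable def fmax (A : Finset ℕ) : ℕ := sSup (A : Set ℕ)

/-- `α` is a partition of the finite set `F ⊆ ℕ`. -/
def IsPartitionOfSet (F : Finset ℕ) (α : Finset (Finset ℕ)) : Prop :=
  (∀ V ∈ α, V.Nonempty) ∧ (∀ V ∈ α, V ⊆ F) ∧ (∀ m ∈ F, ∃ V ∈ α, m ∈ V) ∧
    ∀ V ∈ α, ∀ W ∈ α, V ≠ W → V ∩ W = ∅

/-- `α` is a partition of `{1,…,n}`. -/
def IsPartitionOf (n : ℕ) (α : Finset (Finset ℕ)) : Prop :=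
  IsPartitionOfSet (Finset.Icc 1 n) α

/-- Two distinct blocks of the family `π` cross: there are `a < b < c < d` with
`a, c` in one block and `b, d` in a different block. -/
def IsCrossing (π : Finset (Finset ℕ)) : Prop :=
  ∃ A ∈ π, ∃ B ∈ π, A ≠ B ∧
    ∃ a ∈ A, ∃ b ∈ B, ∃ c ∈ A, ∃ d ∈ B, a < b ∧ b < c ∧ c < d

/-- `α ∈ NC(n)`: a non-crossing partition of `{1,…,n}`. -/
def IsNCPartition (n : ℕ) (α : Finset (Finset ℕ)) : Prop :=
  IsPartitionOf n α ∧ ¬ IsCrossing α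

/-- Reverse refinement order `α ≤ β`: every block of `α` is contained in a block of `β`
(equivalently, every block of `β` is a union of blocks of `α`). -/
def Refines (α β : Finset (Finset ℕ)) : Prop := ∀ V ∈ α, ∃ W ∈ β, V ⊆ W

/-- The partial order `α ≪ β`: `α ≤ β` and for every block `W` of `β` there is a block
`V` of `α` containing both `min W` and `max W`. -/
def LL (α β : Finset (Finset ℕ)) : Prop :=
  Refines α β ∧ ∀ W ∈ β, ∃ V ∈ α, fmin W ∈ V ∧ fmax W ∈ V

/-- A block `V` (of `α`) is `β`-special: some block `W` of `β` has the same min and max. -/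
def SpecialBlock (β : Finset (Finset ℕ)) (V : Finset ℕ) : Prop :=
  ∃ W ∈ β, fmin V = fmin W ∧ fmax V = fmax W

/-- `V` is an outer block of `α`: no block of `α` strictly nests around it. -/
def OuterBlock (α : Finset (Finset ℕ)) (V : Finset ℕ) : Prop :=
  ∀ V' ∈ α, ¬ (fmin V' < fmin V ∧ fmax V < fmax V')

/-- `π` is a linked partition of the finite set `F ⊆ ℕ`. -/
def IsLinkedPartitionOfSet (F : Finset ℕ) (π : Finset (Finset ℕ)) : Prop :=
  (∀ A ∈ π, A.Nonempty) ∧ (∀ A ∈ π, A ⊆ F) ∧ (∀ m ∈ F, ∃ A ∈ π, m ∈ A) ∧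
    ∀ A ∈ π, ∀ B ∈ π, A ≠ B →
      A ∩ B = ∅ ∨
        (2 ≤ A.card ∧ 2 ≤ B.card ∧ (A ∩ B).card = 1 ∧ fmin A ≠ fmin B ∧
          ∀ x ∈ A ∩ B, x = fmin A ∨ x = fmin B)

/-- `π ∈ NCL(F)`: a non-crossing linked partition of the finite set `F`. -/
def IsNCLOfSet (F : Finset ℕ) (π : Finset (Finset ℕ)) : Prop :=
  IsLinkedPartitionOfSet F π ∧ ¬ IsCrossing π

/-- `π ∈ NCL(n)`: a non-crossing linked partition of `{1,…,n}`. -/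
def IsNCL (n : ℕ) (π : Finset (Finset ℕ)) : Prop :=
  IsNCLOfSet (Finset.Icc 1 n) π

/-- The number of blocks of `π` containing `m`. -/
noncomputable def coverCount (π : Finset (Finset ℕ)) (m : ℕ) : ℕ :=
  (π.filter fun A => m ∈ A).card

/-- `m` is singly-covered by `π`: it lies in exactly one block. -/
def SinglyCovered (π : Finset (Finset ℕ)) (m : ℕ) : Prop := coverCount π m = 1

/-- `m` is doubly-covered by `π`: it lies in exactly two blocks. -/
def DoublyCovered (π : Finset (Finset ℕ)) (m : ℕ) : Prop := coverCount π m = 2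

/-- The partition `π̂` generated by the blocks of `π`: its blocks are the connected
components of the ground set under the relation of lying in a common block of `π`. -/
noncomputable def genPart (π : Finset (Finset ℕ)) : Finset (Finset ℕ) :=
  (π.sup id).image fun m =>
    (π.sup id).filter fun x =>
      Relation.EqvGen (fun a b => ∃ A ∈ π, a ∈ A ∧ b ∈ A) m x

/-- The unlinking `π̌` of a linked partition `π`. -/
noncomputable def unlink (π : Finset (Finset ℕ)) : Finset (Finset ℕ) :=
  π.image fun A => if SinglyCovered π (fmin A) then A else A.erase (fmin A)

/-- The block of `α` containing `m` (empty if there is none). -/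
noncomputable def blockOf (α : Finset (Finset ℕ)) (m : ℕ) : Finset ℕ :=
  (α.filter fun V => m ∈ V).sup id

/-- The successor of `m` in the cycle on the block `V` (elements in increasing order). -/
noncomputable def nextInBlock (V : Finset ℕ) (m : ℕ) : ℕ :=
  if m = fmax V then fmin V else fmin (V.filter fun x => m < x)

/-- The predecessor of `m` in the cycle on the block `V`. -/
noncomputable def prevInBlock (V : Finset ℕ) (m : ℕ) : ℕ :=
  if m = fmin V then fmax V else fmax (V.filter fun x => x < m)

/-- The permutation `P_α` associated to a partition `α`, as a function: each block
`{i₁ < i₂ < ⋯ < iₘ}` becomes the cycle `i₁ ↦ i₂ ↦ ⋯ ↦ iₘ ↦ i₁`. -/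
noncomputable def permOf (α : Finset (Finset ℕ)) (m : ℕ) : ℕ :=
  if m ∈ blockOf α m then nextInBlock (blockOf α m) m else m

/-- The inverse permutation `P_α⁻¹`, as a function. -/
noncomputable def permOfInv (α : Finset (Finset ℕ)) (m : ℕ) : ℕ :=
  if m ∈ blockOf α m then prevInBlock (blockOf α m) m else m

/-- The action `τ·α` of a map `τ` on a partition `α = {V₁,…,V_p}`, giving
`{τ(V₁),…,τ(V_p)}`. -/
def mapPart (τ : ℕ → ℕ) (α : Finset (Finset ℕ)) : Finset (Finset ℕ) :=
  α.image fun V => V.image τ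

/-- The cycled unlinking `π° := P_{π̂}⁻¹ · π̌`. -/
noncomputable def cycUnlink (π : Finset (Finset ℕ)) : Finset (Finset ℕ) :=
  mapPart (permOfInv (genPart π)) (unlink π)

/-- `NC(n)` as a finset. -/
noncomputable def NCF (n : ℕ) : Finset (Finset (Finset ℕ)) :=
  ((Finset.Icc 1 n).powerset.powerset).filter (IsNCPartition n)

/-- `NCL(n)` as a finset. -/
noncomputable def NCLF (n : ℕ) : Finset (Finset (Finset ℕ)) :=
  ((Finset.Icc 1 n).powerset.powerset).filter (IsNCL n)

/-- The restriction `π|_E`: the blocks of `π` contained in `E`. -/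
def restrictL (π : Finset (Finset ℕ)) (E : Finset ℕ) : Finset (Finset ℕ) :=
  π.filter fun A => A ⊆ E

/-- The partition `β₀` obtained from `β` by leaving blocks of size `≤ 2` intact and
breaking each block `W` with `|W| ≥ 3` into the doubleton `{min W, max W}` together
with `|W| - 2` singletons. -/
noncomputable def breakBlocks (β : Finset (Finset ℕ)) : Finset (Finset ℕ) :=
  β.biUnion fun W =>
    if W.card ≤ 2 then {W}
    else insert {fmin W, fmax W} ((W \ {fmin W, fmax W}).image fun x => ({x} : Finset ℕ))


def Ncr (α : Finset (Finset ℕ)) : Prop :=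
  ∀ A ∈ α, ∀ B ∈ α, ∀ a ∈ A, ∀ b ∈ B, ∀ c ∈ A, ∀ d ∈ B, a < b → b < c → c < d → A = B

def Cov (F : Finset ℕ) (α : Finset (Finset ℕ)) : Prop := ∀ x ∈ F, ∃ V ∈ α, x ∈ V

structure NCp (F : Finset ℕ) (α : Finset (Finset ℕ)) : Prop where
  ne : ∀ V ∈ α, ∃ x, x ∈ V
  sub : ∀ V ∈ α, ∀ x ∈ V, x ∈ F
  cov : Cov F α
  dis : ∀ V ∈ α, ∀ W ∈ α, ∀ x ∈ V, x ∈ W → V = W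
  nc : Ncr α

def Inn (α : Finset (Finset ℕ)) (V : Finset ℕ) : Prop :=
  ∃ W ∈ α, ∃ x ∈ W, ∃ y ∈ W, ∀ v ∈ V, x < v ∧ v < y

noncomputable def ncJoin (a b : ℕ) (β γ : Finset (Finset ℕ)) : Finset (Finset ℕ) :=
  β ∪ γ.image (fun C => if b ∈ C then insert a C else C)

lemma mem_ncJoin {a b : ℕ} {β γ : Finset (Finset ℕ)} {V : Finset ℕ} :
    V ∈ ncJoin a b β γ ↔ V ∈ β ∨ (∃ C ∈ γ, b ∈ C ∧ V = insert a C) ∨ (V ∈ γ ∧ b ∉ V) := by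
  unfold ncJoin
  grind

def Sec (a b : ℕ) (α : Finset (Finset ℕ)) : Prop :=
  ∃ A ∈ α, a ∈ A ∧ b ∈ A ∧ ∀ x ∈ A, x = a ∨ b ≤ x

lemma ncJoin_mem {a b : ℕ} {F X Y : Finset ℕ} (ha : ∀ x ∈ F, a < x) (hb : b ∈ F)
    (hX : ∀ x, x ∈ X ↔ x ∈ F ∧ x < b) (hY : ∀ x, x ∈ Y ↔ x ∈ F ∧ b ≤ x)
    {β γ : Finset (Finset ℕ)} (h1 : NCp X β) (h2 : NCp Y γ) :
    NCp (insert a F) (ncJoin a b β γ) := by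
  obtain ⟨n1, s1, c1, d1, k1⟩ := h1
  obtain ⟨n2, s2, c2, d2, k2⟩ := h2
  have hab := ha b hb
  obtain ⟨B, hB, hbB⟩ := c2 b (by grind)
  refine ⟨?_, ?_, ?_, ?_, ?_⟩
  · intro V hV
    rw [mem_ncJoin] at hV
    grind
  · intro V hV
    rw [mem_ncJoin] at hV
    grind
  · intro x hx
    simp only [mem_ncJoin]
    by_cases h : x = a
    · exact ⟨insert a B, by grind⟩
    · by_cases h' : x < b
      · obtain ⟨V, hV⟩ := c1 x (by grind)
        exact ⟨V, by grind⟩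
      · obtain ⟨V, hV⟩ := c2 x (by grind)
        by_cases hh : b ∈ V
        · exact ⟨insert a V, by grind⟩
        · exact ⟨V, by grind⟩
  · intro V hV W hW x hxV hxW
    rw [mem_ncJoin] at hV hW
    rcases hV with hV | ⟨C, hC, hbC, rfl⟩ | ⟨hV, hbV⟩ <;>
    rcases hW with hW | ⟨D, hD, hbD, rfl⟩ | ⟨hW, hbW⟩ <;> grind
  · intro V hV W hW x hx y hy z hz w hw hxy hyz hzw
    rw [mem_ncJoin] at hV hW
    rcases hV with hV | ⟨C, hC, hbC, rfl⟩ | ⟨hV, hbV⟩ <;>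
    rcases hW with hW | ⟨D, hD, hbD, rfl⟩ | ⟨hW, hbW⟩
    · exact k1 V hV W hW x hx y hy z hz w hw hxy hyz hzw
    · grind
    · grind
    · grind
    · grind
    · by_cases h : x = a
      · have := s2 W hW y hy
        have := k2 C hC W hW b hbC y hy z (by grind) w hw (by grind) hyz hzw
        grind
      · have := k2 C hC W hW x (by grind) y hy z (by grind) w hw hxy hyz hzw
        grind
    · grind
    · have := s2 V hV x hx
      have := k2 V hV D hD x hx y (by grind) z hz w (by grind) hxy hyz hzw
      grind
    · exact k2 V hV W hW x hx y hy z hz w hw hxy hyz hzw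

lemma ncJoin_sec {a b : ℕ} {F Y : Finset ℕ} (hb : b ∈ F)
    (hY : ∀ x, x ∈ Y ↔ x ∈ F ∧ b ≤ x)
    {β γ : Finset (Finset ℕ)} (h2 : NCp Y γ) :
    Sec a b (ncJoin a b β γ) := by
  obtain ⟨B, hB, hbB⟩ := h2.cov b (by grind)
  refine ⟨insert a B, mem_ncJoin.2 (Or.inr (Or.inl ⟨B, hB, hbB, rfl⟩)), by simp, by simp [hbB], ?_⟩
  have := h2.sub B hB
  grind

/-- dichotomy for the blocks -/
lemma nc_dich {a b : ℕ} {F X : Finset ℕ} (ha : ∀ x ∈ F, a < x) (hb : b ∈ F)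
    (hX : ∀ x, x ∈ X ↔ x ∈ F ∧ x < b)
    {α : Finset (Finset ℕ)} (h : NCp (insert a F) α) (hs : Sec a b α) :
    ∀ V ∈ α, ¬ V ⊆ X → ∀ x ∈ V, x = a ∨ b ≤ x := by
  obtain ⟨n, s, c, d, k⟩ := h
  obtain ⟨A, hA, haA, hbA, hm⟩ := hs
  intro V hV hVX x hx
  by_contra hcon
  push Not at hcon
  obtain ⟨y, hy, hyX⟩ := Finset.not_subset.1 hVX
  have hxF := s V hV x hx
  have hyF := s V hV y hy
  by_cases hVA : V = A
  · grind
  have : y ≠ a := fun h => hVA (d V hV A hA a (h ▸ hy) haA)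
  have : y ≠ b := fun h => hVA (d V hV A hA b (h ▸ hy) hbA)
  exact hVA (k A hA V hV a haA x hx b hbA y hy (by grind) (by grind) (by grind)).symm

lemma nc_split1 {a b : ℕ} {F X : Finset ℕ} (ha : ∀ x ∈ F, a < x) (hb : b ∈ F)
    (hX : ∀ x, x ∈ X ↔ x ∈ F ∧ x < b)
    {α : Finset (Finset ℕ)} (h : NCp (insert a F) α) (hs : Sec a b α) :
    NCp X (α.filter (· ⊆ X)) := by
  have hd := nc_dich ha hb hX h hs
  obtain ⟨n, s, c, d, k⟩ := h
  refine ⟨by grind, by grind, ?_, by grind, ?_⟩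
  · intro x hx
    obtain ⟨V, hV, hxV⟩ := c x (by grind)
    exact ⟨V, by grind⟩
  · intro A hA B hB
    exact k A (by grind) B (by grind)

lemma nc_split2 {a b : ℕ} {F X Y : Finset ℕ} (ha : ∀ x ∈ F, a < x) (hb : b ∈ F)
    (hX : ∀ x, x ∈ X ↔ x ∈ F ∧ x < b) (hY : ∀ x, x ∈ Y ↔ x ∈ F ∧ b ≤ x)
    {α : Finset (Finset ℕ)} (h : NCp (insert a F) α) (hs : Sec a b α) :
    NCp Y ((α.filter (¬ · ⊆ X)).image (·.erase a)) := by
  have hd := nc_dich ha hb hX h hs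
  obtain ⟨n, s, c, d, k⟩ := h
  obtain ⟨A, hA, haA, hbA, hm⟩ := hs
  have hab := ha b hb
  have key : ∀ V ∈ α, ¬ V ⊆ X → a ∈ V → V = A := fun V hV _ haV => d V hV A hA a haV haA
  refine ⟨?_, ?_, ?_, ?_, ?_⟩
  · intro V hV
    simp only [Finset.mem_image, Finset.mem_filter] at hV
    obtain ⟨W, ⟨hW, hWX⟩, rfl⟩ := hV
    obtain ⟨x, hx⟩ := n W hW
    by_cases h : a ∈ W
    · exact ⟨b, by grind⟩
    · exact ⟨x, by grind⟩
  · intro V hV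
    simp only [Finset.mem_image, Finset.mem_filter] at hV
    obtain ⟨W, ⟨hW, hWX⟩, rfl⟩ := hV
    grind
  · intro x hx
    obtain ⟨V, hV, hxV⟩ := c x (by grind)
    refine ⟨V.erase a, Finset.mem_image_of_mem _ (Finset.mem_filter.2 ⟨hV, ?_⟩), by grind⟩
    intro h
    grind
  · intro V hV W hW
    simp only [Finset.mem_image, Finset.mem_filter] at hV hW
    obtain ⟨V, ⟨hV, hVX⟩, rfl⟩ := hV
    obtain ⟨W, ⟨hW, hWX⟩, rfl⟩ := hW
    intro x hx hx'
    rw [d V hV W hW x (by grind) (by grind)]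
  · intro V hV W hW
    simp only [Finset.mem_image, Finset.mem_filter] at hV hW
    obtain ⟨V, ⟨hV, hVX⟩, rfl⟩ := hV
    obtain ⟨W, ⟨hW, hWX⟩, rfl⟩ := hW
    intro x hx y hy z hz w hw h1 h2 h3
    rw [k V hV W hW x (by grind) y (by grind) z (by grind) w (by grind) h1 h2 h3]

lemma nc_join_split {a b : ℕ} {F X : Finset ℕ} (ha : ∀ x ∈ F, a < x) (hb : b ∈ F)
    (hX : ∀ x, x ∈ X ↔ x ∈ F ∧ x < b)
    {α : Finset (Finset ℕ)} (h : NCp (insert a F) α) (hs : Sec a b α) :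
    ncJoin a b (α.filter (· ⊆ X)) ((α.filter (¬ · ⊆ X)).image (·.erase a)) = α := by
  obtain ⟨n, s, c, d, k⟩ := h
  obtain ⟨A, hA, haA, hbA, hm⟩ := hs
  have hab := ha b hb
  have hAX : ¬ A ⊆ X := fun h => by grind
  have key : ∀ V ∈ α, a ∈ V → V = A := fun V hV haV => d V hV A hA a haV haA
  have key' : ∀ V ∈ α, b ∈ V → V = A := fun V hV haV => d V hV A hA b haV hbA
  ext V
  rw [mem_ncJoin]
  simp only [Finset.mem_image, Finset.mem_filter]
  constructor
  · rintro (⟨h, -⟩ | ⟨C, ⟨D, ⟨hD, -⟩, rfl⟩, hbC, rfl⟩ | ⟨⟨D, ⟨hD, -⟩, rfl⟩, hbV⟩)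
    · exact h
    · have := key' D hD (by grind)
      subst this
      rwa [Finset.insert_erase haA]
    · by_cases haD : a ∈ D
      · have := key D hD haD
        grind
      · rwa [Finset.erase_eq_of_notMem haD]
  · intro hV
    by_cases hVX : V ⊆ X
    · exact Or.inl ⟨hV, hVX⟩
    · by_cases hbV : b ∈ V
      · have := key' V hV hbV
        subst this
        refine Or.inr (Or.inl ⟨_, ⟨V, ⟨hV, hVX⟩, rfl⟩, by grind, ?_⟩)
        rw [Finset.insert_erase haA]
      · refine Or.inr (Or.inr ⟨⟨V, ⟨hV, hVX⟩, ?_⟩, hbV⟩)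
        apply Finset.erase_eq_of_notMem
        intro haV
        have := key V hV haV
        grind

lemma nc_split_join1 {a b : ℕ} {F X Y : Finset ℕ}
    (hX : ∀ x, x ∈ X ↔ x ∈ F ∧ x < b) (hY : ∀ x, x ∈ Y ↔ x ∈ F ∧ b ≤ x)
    {β γ : Finset (Finset ℕ)} (h1 : NCp X β) (h2 : NCp Y γ) :
    (ncJoin a b β γ).filter (· ⊆ X) = β := by
  obtain ⟨n1, s1, c1, d1, k1⟩ := h1
  obtain ⟨n2, s2, c2, d2, k2⟩ := h2
  ext V
  rw [Finset.mem_filter, mem_ncJoin]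
  constructor
  · rintro ⟨h | ⟨C, hC, hbC, rfl⟩ | ⟨h, hb⟩, hX⟩
    · exact h
    · grind
    · grind
  · intro h
    exact ⟨Or.inl h, s1 V h⟩

lemma nc_split_join2 {a b : ℕ} {F X Y : Finset ℕ} (ha : ∀ x ∈ F, a < x)
    (hX : ∀ x, x ∈ X ↔ x ∈ F ∧ x < b) (hY : ∀ x, x ∈ Y ↔ x ∈ F ∧ b ≤ x)
    {β γ : Finset (Finset ℕ)} (h1 : NCp X β) (h2 : NCp Y γ) :
    ((ncJoin a b β γ).filter (¬ · ⊆ X)).image (·.erase a) = γ := by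
  obtain ⟨n1, s1, c1, d1, k1⟩ := h1
  obtain ⟨n2, s2, c2, d2, k2⟩ := h2
  have hnot : ∀ C ∈ γ, a ∉ C := by grind
  ext V
  simp only [Finset.mem_image, Finset.mem_filter, mem_ncJoin]
  constructor
  · rintro ⟨W, ⟨h | ⟨C, hC, hbC, rfl⟩ | ⟨h, hb⟩, hX⟩, rfl⟩
    · grind
    · rwa [Finset.erase_insert (hnot C hC)]
    · rwa [Finset.erase_eq_of_notMem (hnot W h)]
  · intro h
    by_cases hbV : b ∈ V
    · exact ⟨insert a V, ⟨Or.inr (Or.inl ⟨V, h, hbV, rfl⟩), by grind⟩,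
        Finset.erase_insert (hnot V h)⟩
    · refine ⟨V, ⟨Or.inr (Or.inr ⟨h, hbV⟩), ?_⟩, Finset.erase_eq_of_notMem (hnot V h)⟩
      intro hh
      obtain ⟨x, hx⟩ := n2 V h
      grind

noncomputable def NCfam (F : Finset ℕ) : Finset (Finset (Finset ℕ)) :=
  F.powerset.powerset.filter (NCp F)

lemma mem_NCfam {F : Finset ℕ} {α : Finset (Finset ℕ)} : α ∈ NCfam F ↔ NCp F α := by
  unfold NCfam
  simp only [Finset.mem_filter, Finset.mem_powerset, and_iff_right_iff_imp]
  intro h V hV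
  exact Finset.mem_powerset.2 (h.sub V hV)

section NCsum
variable {R : Type*} [CommRing R]

noncomputable def wtM (s u : ℕ → R) (α : Finset (Finset ℕ)) (V : Finset ℕ) : R :=
  if Inn α V then u (V.card - 1) else s (V.card - 1)

noncomputable def wtH (s u : ℕ → R) (k a : ℕ) (α : Finset (Finset ℕ)) (V : Finset ℕ) : R :=
  if a ∈ V then s (V.card - 1 + k) else wtM s u α V

noncomputable def sumM (s u : ℕ → R) (F : Finset ℕ) : R :=
  ∑ α ∈ NCfam F, ∏ V ∈ α, wtM s u α V

noncomputable def sumH (s u : ℕ → R) (k a : ℕ) (F : Finset ℕ) : R :=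
  ∑ α ∈ NCfam F, ∏ V ∈ α, wtH s u k a α V

lemma nc_join_inn {a b : ℕ} {F X Y : Finset ℕ} (ha : ∀ x ∈ F, a < x) (hb : b ∈ F)
    (hX : ∀ x, x ∈ X ↔ x ∈ F ∧ x < b) (hY : ∀ x, x ∈ Y ↔ x ∈ F ∧ b ≤ x)
    {β γ : Finset (Finset ℕ)} (h1 : NCp X β) (h2 : NCp Y γ) {C : Finset ℕ} (hC : C ∈ γ)
    (hbC : b ∉ C) : Inn (ncJoin a b β γ) C ↔ Inn γ C := by
  obtain ⟨n1, s1, -, -, -⟩ := h1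
  obtain ⟨n2, s2, -, -, -⟩ := h2
  have hab := ha b hb
  obtain ⟨c, hc⟩ := n2 C hC
  have hge : ∀ c ∈ C, b < c := by
    intro c hc
    have := s2 C hC c hc
    grind
  have hbc := hge c hc
  constructor
  · rintro ⟨W, hW, x, hx, y, hy, h⟩
    have hh := h c hc
    rw [mem_ncJoin] at hW
    rcases hW with hW | ⟨D, hD, hbD, rfl⟩ | ⟨hW, hbW⟩
    · have := s1 W hW y hy
      grind
    · refine ⟨D, hD, ?_⟩
      have hyD : y ∈ D := by grind
      by_cases hxa : x = a
      · exact ⟨b, hbD, y, hyD, fun v hv => ⟨hge v hv, (h v hv).2⟩⟩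
      · exact ⟨x, by grind, y, hyD, h⟩
    · exact ⟨W, hW, x, hx, y, hy, h⟩
  · rintro ⟨W, hW, x, hx, y, hy, h⟩
    by_cases hbW : b ∈ W
    · exact ⟨insert a W, mem_ncJoin.2 (Or.inr (Or.inl ⟨W, hW, hbW, rfl⟩)), x,
        Finset.mem_insert_of_mem hx, y, Finset.mem_insert_of_mem hy, h⟩
    · exact ⟨W, mem_ncJoin.2 (Or.inr (Or.inr ⟨hW, hbW⟩)), x, hx, y, hy, h⟩

lemma nc_join_prod (s u : ℕ → R) (k : ℕ) {a b : ℕ} {F X Y : Finset ℕ}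
    (ha : ∀ x ∈ F, a < x) (hb : b ∈ F)
    (hX : ∀ x, x ∈ X ↔ x ∈ F ∧ x < b) (hY : ∀ x, x ∈ Y ↔ x ∈ F ∧ b ≤ x)
    {β γ : Finset (Finset ℕ)} (h1 : NCp X β) (h2 : NCp Y γ) :
    ∏ V ∈ ncJoin a b β γ, wtH s u k a (ncJoin a b β γ) V
      = (∏ V ∈ β, wtM u u β V) * ∏ V ∈ γ, wtH s u (k + 1) b γ V := by
  have hinn := fun C hC hbC => nc_join_inn ha hb hX hY h1 h2 (C := C) hC hbC
  obtain ⟨n1, s1, -, -, -⟩ := h1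
  obtain ⟨n2, s2, c2, d2, -⟩ := h2
  have hab := ha b hb
  obtain ⟨B, hB, hbB⟩ := c2 b (by grind)
  have hBJ : insert a B ∈ ncJoin a b β γ := mem_ncJoin.2 (Or.inr (Or.inl ⟨B, hB, hbB, rfl⟩))
  have hnot : ∀ C ∈ γ, a ∉ C := by grind
  generalize hJ : ncJoin a b β γ = J at *
  have hJ' : J = β ∪ γ.image (fun C => if b ∈ C then insert a C else C) := hJ.symm
  rw [Finset.prod_congr hJ' (fun _ _ => rfl), Finset.prod_union, Finset.prod_image]
  · congr 1
    · apply Finset.prod_congr rfl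
      intro V hV
      have h1 : a ∉ V := by grind
      have h2 : Inn J V := by
        refine ⟨insert a B, hBJ, a, by simp, b, by simp [hbB], ?_⟩
        intro v hv
        have := s1 V hV v hv
        grind
      simp [wtH, wtM, h1, h2]
    · apply Finset.prod_congr rfl
      intro C hC
      by_cases hbC : b ∈ C
      · have : 1 ≤ C.card := Finset.card_pos.2 ⟨b, hbC⟩
        simp only [wtH, hbC, if_true, Finset.mem_insert_self, Finset.card_insert_of_notMem (hnot C hC)]
        congr 1
        omega
      · simp [wtH, wtM, hbC, hnot C hC, hinn C hC hbC]
  · intro C hC D hD h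
    have := hnot C hC
    have := hnot D hD
    simp only at h
    have e : ∀ E : Finset ℕ, a ∉ E → (if b ∈ E then insert a E else E : Finset ℕ).erase a = E := by
      intro E hE
      split_ifs
      · exact Finset.erase_insert hE
      · exact Finset.erase_eq_of_notMem hE
    rw [← e C (hnot C hC), h, e D (hnot D hD)]
  · rw [Finset.disjoint_left]
    intro V hV hV'
    simp only [Finset.mem_image] at hV'
    obtain ⟨C, hC, rfl⟩ := hV'
    obtain ⟨c, hc⟩ := n2 C hC
    have hcY := s2 C hC c hc
    have hcX := s1 _ hV c (by split_ifs <;> simp [hc])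
    grind

lemma nc_sec_sum (s u : ℕ → R) (k : ℕ) {a b : ℕ} {F : Finset ℕ}
    (ha : ∀ x ∈ F, a < x) (hb : b ∈ F) :
    ∑ α ∈ (NCfam (insert a F)).filter (Sec a b), ∏ V ∈ α, wtH s u k a α V
      = sumM u u (F.filter (· < b)) * sumH s u (k + 1) b (F.filter (b ≤ ·)) := by
  have hX : ∀ x, x ∈ F.filter (· < b) ↔ x ∈ F ∧ x < b := by simp
  have hY : ∀ x, x ∈ F.filter (b ≤ ·) ↔ x ∈ F ∧ b ≤ x := by simp
  generalize F.filter (· < b) = X at *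
  generalize F.filter (b ≤ ·) = Y at *
  rw [sumM, sumH, Finset.sum_mul_sum, ← Finset.sum_product']
  symm
  refine Finset.sum_bij' (fun p _ => ncJoin a b p.1 p.2)
    (fun α _ => (α.filter (· ⊆ X), (α.filter (¬ · ⊆ X)).image (·.erase a))) ?_ ?_ ?_ ?_ ?_
  · rintro ⟨β, γ⟩ h
    simp only [Finset.mem_product, mem_NCfam] at h
    rw [Finset.mem_filter, mem_NCfam]
    exact ⟨ncJoin_mem ha hb hX hY h.1 h.2, ncJoin_sec hb hY h.2⟩
  · intro α h
    rw [Finset.mem_filter, mem_NCfam] at h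
    simp only [Finset.mem_product, mem_NCfam]
    exact ⟨nc_split1 ha hb hX h.1 h.2, nc_split2 ha hb hX hY h.1 h.2⟩
  · rintro ⟨β, γ⟩ h
    simp only [Finset.mem_product, mem_NCfam] at h
    exact Prod.ext (nc_split_join1 hX hY h.1 h.2) (nc_split_join2 ha hX hY h.1 h.2)
  · intro α h
    rw [Finset.mem_filter, mem_NCfam] at h
    exact nc_join_split ha hb hX h.1 h.2
  · rintro ⟨β, γ⟩ h
    simp only [Finset.mem_product, mem_NCfam] at h
    exact (nc_join_prod s u k ha hb hX hY h.1 h.2).symm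

lemma nc_single_sum (s u : ℕ → R) (k : ℕ) {a : ℕ} {F : Finset ℕ}
    (ha : ∀ x ∈ F, a < x) :
    ∑ α ∈ (NCfam (insert a F)).filter ({a} ∈ ·), ∏ V ∈ α, wtH s u k a α V
      = s k * sumM s u F := by
  rw [sumM, Finset.mul_sum]
  symm
  have hnot : ∀ α ∈ NCfam F, {a} ∉ α := by
    intro α h
    rw [mem_NCfam] at h
    intro h'
    have := h.sub _ h' a (by simp)
    grind
  refine Finset.sum_bij' (fun α _ => insert {a} α) (fun α _ => α.erase {a}) ?_ ?_ ?_ ?_ ?_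
  · intro α h
    rw [mem_NCfam] at h
    rw [Finset.mem_filter, mem_NCfam]
    refine ⟨?_, by simp⟩
    obtain ⟨n, s, c, d, k⟩ := h
    refine ⟨?_, by grind, ?_, by grind, ?_⟩
    · intro V hV
      rw [Finset.mem_insert] at hV
      rcases hV with rfl | hV
      · exact ⟨a, by simp⟩
      · exact n V hV
    · intro x hx
      by_cases h : x = a
      · exact ⟨{a}, by simp, by simp [h]⟩
      · obtain ⟨V, hV, hxV⟩ := c x (by grind)
        exact ⟨V, by grind⟩
    · intro V hV W hW x hx y hy z hz w hw hxy hyz hzw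
      rw [Finset.mem_insert] at hV hW
      rcases hV with rfl | hV
      · simp at hx hz
        omega
      rcases hW with rfl | hW
      · simp at hy hw
        omega
      exact k V hV W hW x hx y hy z hz w hw hxy hyz hzw
  · intro α h
    rw [Finset.mem_filter, mem_NCfam] at h
    rw [mem_NCfam]
    obtain ⟨⟨n, s, c, d, k⟩, h0⟩ := h
    have key : ∀ V ∈ α, V ≠ {a} → a ∉ V := by
      intro V hV hne haV
      exact hne (d V hV {a} h0 a haV (by simp))
    refine ⟨by grind, by grind, ?_, by grind, ?_⟩
    · intro x hx
      obtain ⟨V, hV, hxV⟩ := c x (by grind)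
      refine ⟨V, ?_, hxV⟩
      rw [Finset.mem_erase]
      refine ⟨?_, hV⟩
      rintro rfl
      have := ha x hx
      simp at hxV
      omega
    · intro V hV W hW
      exact k V (Finset.mem_of_mem_erase hV) W (Finset.mem_of_mem_erase hW)
  · intro α h
    exact Finset.erase_insert (hnot α h)
  · intro α h
    exact Finset.insert_erase (Finset.mem_filter.1 h).2
  · intro α h
    rw [Finset.prod_insert (hnot α h)]
    rw [mem_NCfam] at h
    congr 1
    · simp [wtH]
    · apply Finset.prod_congr rfl
      intro V hV
      have h1 : a ∉ V := by
        have := h.sub V hV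
        grind
      have h2 : Inn (insert {a} α) V ↔ Inn α V := by
        obtain ⟨v, hv⟩ := h.ne V hV
        constructor
        · rintro ⟨W, hW, x, hx, y, hy, hh⟩
          rw [Finset.mem_insert] at hW
          rcases hW with rfl | hW
          · have := hh v hv
            simp at hx hy
            omega
          · exact ⟨W, hW, x, hx, y, hy, hh⟩
        · rintro ⟨W, hW, hh⟩
          exact ⟨W, Finset.mem_insert_of_mem hW, hh⟩
      simp [wtH, wtM, h1, h2]

lemma nc_rec (s u : ℕ → R) (k : ℕ) {a : ℕ} {F : Finset ℕ} (ha : ∀ x ∈ F, a < x) :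
    sumH s u k a (insert a F) = s k * sumM s u F
      + ∑ b ∈ F, sumM u u (F.filter (· < b)) * sumH s u (k + 1) b (F.filter (b ≤ ·)) := by
  rw [← nc_single_sum s u k ha, ← Finset.sum_congr rfl (fun b hb => nc_sec_sum s u k ha hb),
    ← Finset.sum_biUnion, sumH, ← Finset.sum_filter_add_sum_filter_not _ ({a} ∈ ·)]
  · congr 1
    apply Finset.sum_congr _ (fun _ _ => rfl)
    ext α
    simp only [Finset.mem_filter, mem_NCfam, Finset.mem_biUnion]
    constructor
    · rintro ⟨h, h0⟩
      obtain ⟨A, hA, haA⟩ := h.cov a (by simp)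
      have hne : (A.erase a).Nonempty := by
        by_contra hc
        rw [Finset.not_nonempty_iff_eq_empty, Finset.erase_eq_empty_iff] at hc
        grind
      have hmem := Finset.min'_mem _ hne
      have hle := fun x hx => Finset.min'_le (A.erase a) x hx
      refine ⟨(A.erase a).min' hne, ?_, h, A, hA, haA, ?_, ?_⟩
      · have := h.sub A hA ((A.erase a).min' hne) (by grind)
        grind
      · grind
      · intro x hx
        by_cases hxa : x = a
        · exact Or.inl hxa
        · exact Or.inr (hle x (Finset.mem_erase.2 ⟨hxa, hx⟩))
    · rintro ⟨b, hb, h, A, hA, haA, hbA, hm⟩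
      refine ⟨h, fun h0 => ?_⟩
      have := h.dis A hA {a} h0 a haA (by simp)
      subst this
      have := ha b hb
      simp at hbA
      omega
  · intro b hb c hc hbc
    rw [Function.onFun, Finset.disjoint_left]
    intro α h1 h2
    simp only [Finset.mem_filter, mem_NCfam] at h1 h2
    obtain ⟨h, A, hA, haA, hbA, hm⟩ := h1
    obtain ⟨-, B, hB, haB, hcB, hm'⟩ := h2
    have := h.dis A hA B hB a haA haB
    subst this
    have h3 := ha b hb
    have h4 := ha c hc
    have h5 := hm c hcB
    have h6 := hm' b hbA
    omega
end NCsum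

def Lk (A B : Finset ℕ) (x : ℕ) : Prop :=
  (∀ y ∈ A, x ≤ y) ∧ (∃ y ∈ A, x < y) ∧ ∃ z ∈ B, z < x

structure NLp (C F : Finset ℕ) (π : Finset (Finset ℕ)) : Prop where
  ne : ∀ V ∈ π, ∃ x, x ∈ V
  sub : ∀ V ∈ π, ∀ x ∈ V, x ∈ F
  cov : Cov C π
  lk : ∀ V ∈ π, ∀ W ∈ π, V ≠ W → ∀ x ∈ V, x ∈ W → Lk V W x ∨ Lk W V x
  nc : Ncr π

def Last (a b : ℕ) (π : Finset (Finset ℕ)) : Prop :=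
  ∃ A ∈ π, a ∈ A ∧ b ∈ A ∧ ∀ x ∈ A, x ≤ b

/-- uniqueness of the block containing the minimum -/
lemma NLp.uniq {C F : Finset ℕ} {π : Finset (Finset ℕ)} (h : NLp C F π) {a : ℕ}
    (ha : ∀ x ∈ F, a ≤ x) : ∀ V ∈ π, ∀ W ∈ π, a ∈ V → a ∈ W → V = W := by
  intro V hV W hW haV haW
  by_contra hne
  rcases h.lk V hV W hW hne a haV haW with ⟨-, -, z, hz, hza⟩ | ⟨-, -, z, hz, hza⟩
  · have := ha z (h.sub W hW z hz)
    omega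
  · have := ha z (h.sub V hV z hz)
    omega

lemma nlJoin_mem {a b : ℕ} {F X Y Z : Finset ℕ} (ha : ∀ x ∈ F, a < x) (hb : b ∈ F)
    (hX : ∀ x, x ∈ X ↔ x = a ∨ (x ∈ F ∧ x < b)) (hY : ∀ x, x ∈ Y ↔ x ∈ F ∧ b < x)
    (hZ : ∀ x, x ∈ Z ↔ x ∈ F ∧ b ≤ x)
    {ρ σ : Finset (Finset ℕ)} (h1 : NLp X X ρ) (h2 : NLp Y Z σ) (h3 : {b} ∉ σ) :
    NLp (insert a F) (insert a F) (ncJoin b a σ ρ) := by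
  have hab := ha b hb
  have huq := h1.uniq (a := a) (by grind)
  obtain ⟨n1, s1, c1, l1, k1⟩ := h1
  obtain ⟨n2, s2, c2, l2, k2⟩ := h2
  have lX : ∀ C ∈ ρ, ∀ x ∈ C, a ≤ x ∧ x < b := by
    intro C hC x hx
    have := s1 C hC x hx
    grind
  have lZ : ∀ C ∈ σ, ∀ x ∈ C, b ≤ x := by
    intro C hC x hx
    have := s2 C hC x hx
    grind
  obtain ⟨B, hB, haB⟩ := c1 a (by grind)
  refine ⟨?_, ?_, ?_, ?_, ?_⟩
  · intro V hV
    rw [mem_ncJoin] at hV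
    rcases hV with hV | ⟨C, hC, hbC, rfl⟩ | ⟨hV, hbV⟩
    · exact n2 V hV
    · exact ⟨b, by simp⟩
    · exact n1 V hV
  · intro V hV
    rw [mem_ncJoin] at hV
    grind
  · intro x hx
    simp only [mem_ncJoin]
    by_cases h : x = b
    · exact ⟨insert b B, by grind⟩
    · by_cases h' : b < x
      · obtain ⟨V, hV⟩ := c2 x (by grind)
        exact ⟨V, by grind⟩
      · obtain ⟨V, hV⟩ := c1 x (by grind)
        by_cases hh : a ∈ V
        · exact ⟨insert b V, by grind⟩
        · exact ⟨V, by grind⟩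
  · have key : ∀ V ∈ σ, ∀ C ∈ ρ, a ∈ C → ∀ x ∈ V, x ∈ insert b C → Lk V (insert b C) x := by
      intro V hV C hC haC x hx hx'
      have hxb : x = b := by
        rw [Finset.mem_insert] at hx'
        rcases hx' with h | h
        · exact h
        · have := lX C hC x h
          have := lZ V hV x hx
          omega
      subst hxb
      refine ⟨lZ V hV, ?_, a, Finset.mem_insert_of_mem haC, hab⟩
      by_contra hcon
      push Not at hcon
      apply h3
      have : V = {x} := by
        ext y
        rw [Finset.mem_singleton]
        constructor
        · intro hy
          have := hcon y hy
          have := lZ V hV y hy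
          omega
        · rintro rfl
          exact hx
      rwa [← this]
    have key2 : ∀ C ∈ ρ, a ∈ C → ∀ W ∈ ρ, a ∉ W → ∀ x ∈ W, x ∈ insert b C →
        Lk W (insert b C) x := by
      intro C hC haC W hW haW x hxW hxC
      have hCW : C ≠ W := by
        rintro rfl
        exact haW haC
      have hxlt := lX W hW x hxW
      have hxC' : x ∈ C := by
        rw [Finset.mem_insert] at hxC
        rcases hxC with h | h
        · omega
        · exact h
      rcases l1 C hC W hW hCW x hxC' hxW with ⟨h, -, -⟩ | ⟨h, h', z, hz, hzx⟩
      · have := h a haC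
        have : x = a := by omega
        subst this
        exact absurd hxW haW
      · exact ⟨h, h', z, Finset.mem_insert_of_mem hz, hzx⟩
    intro V hV W hW hne x hxV hxW
    rw [mem_ncJoin] at hV hW
    rcases hV with hV | ⟨C, hC, hbC, rfl⟩ | ⟨hV, hbV⟩ <;>
    rcases hW with hW | ⟨D, hD, hbD, rfl⟩ | ⟨hW, hbW⟩
    · exact l2 V hV W hW hne x hxV hxW
    · exact Or.inl (key V hV D hD hbD x hxV hxW)
    · have := lX W hW x hxW
      have := lZ V hV x hxV
      omega
    · exact Or.inr (key W hW C hC hbC x hxW hxV)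
    · rw [huq C hC D hD hbC hbD] at hne
      exact absurd rfl hne
    · exact Or.inr (key2 C hC hbC W hW hbW x hxW hxV)
    · have := lX V hV x hxV
      have := lZ W hW x hxW
      omega
    · exact Or.inl (key2 D hD hbD V hV hbV x hxV hxW)
    · exact l1 V hV W hW hne x hxV hxW
  · have lC : ∀ C ∈ ρ, ∀ x ∈ insert b C, x ≤ b := by
      intro C hC x hx
      rw [Finset.mem_insert] at hx
      rcases hx with h | h
      · omega
      · exact (lX C hC x h).2.le
    have mC : ∀ C : Finset ℕ, ∀ x ∈ insert b C, x < b → x ∈ C := by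
      intro C x hx hxb
      rw [Finset.mem_insert] at hx
      rcases hx with h | h
      · omega
      · exact h
    intro V hV W hW x hx y hy z hz w hw hxy hyz hzw
    rw [mem_ncJoin] at hV hW
    rcases hV with hV | ⟨C, hC, hbC, rfl⟩ | ⟨hV, hbV⟩ <;>
    rcases hW with hW | ⟨D, hD, hbD, rfl⟩ | ⟨hW, hbW⟩
    · exact k2 V hV W hW x hx y hy z hz w hw hxy hyz hzw
    · have := lZ V hV x hx
      have := lC D hD y hy
      omega
    · have := lZ V hV x hx
      have := lX W hW y hy
      omega
    · have := lZ W hW y hy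
      have := lC C hC z hz
      omega
    · rw [huq C hC D hD hbC hbD]
    · have := lX W hW w hw
      have := k1 C hC W hW x (mC C x hx (by omega)) y hy z (mC C z hz (by omega)) w hw hxy hyz hzw
      subst this
      exact absurd hbC hbW
    · have := lZ W hW y hy
      have := lX V hV z hz
      omega
    · have := lX V hV z hz
      have := lX V hV x hx
      have hxa : x ≠ a := by
        rintro rfl
        exact hbV hx
      have := k1 D hD V hV a hbD x hx y (mC D y hy (by omega)) z hz (by omega) hxy hyz
      subst this
      exact absurd hbD hbV
    · exact k1 V hV W hW x hx y hy z hz w hw hxy hyz hzw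

lemma nlJoin_last {a b : ℕ} {F X : Finset ℕ} (ha : ∀ x ∈ F, a < x) (hb : b ∈ F)
    (hX : ∀ x, x ∈ X ↔ x = a ∨ (x ∈ F ∧ x < b))
    {ρ σ : Finset (Finset ℕ)} (h1 : NLp X X ρ) :
    Last a b (ncJoin b a σ ρ) := by
  obtain ⟨B, hB, haB⟩ := h1.cov a (by grind)
  have := ha b hb
  refine ⟨insert b B, mem_ncJoin.2 (Or.inr (Or.inl ⟨B, hB, haB, rfl⟩)), by simp [haB], by simp, ?_⟩
  have := h1.sub B hB
  grind

/-- dichotomy for the blocks -/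
lemma nl_dich {a b : ℕ} {F Z : Finset ℕ} (ha : ∀ x ∈ F, a < x) (hb : b ∈ F)
    (hZ : ∀ x, x ∈ Z ↔ x ∈ F ∧ b ≤ x)
    {π : Finset (Finset ℕ)} (h : NLp (insert a F) (insert a F) π) {A : Finset ℕ}
    (hA : A ∈ π) (haA : a ∈ A) (hbA : b ∈ A) (hm : ∀ x ∈ A, x ≤ b) :
    (∀ V ∈ π, ¬ V ⊆ Z → ∀ x ∈ V, x ≤ b) ∧ (∀ V ∈ π, ¬ V ⊆ Z → b ∈ V → V = A) := by
  have hab := ha b hb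
  have huq := h.uniq (a := a) (by grind)
  have key : ∀ V ∈ π, V ≠ A → b ∈ V → V ⊆ Z := by
    intro V hV hne hbV
    rcases h.lk V hV A hA hne b hbV hbA with ⟨h1, -, -⟩ | ⟨h1, -, -⟩
    · intro y hy
      have := h.sub V hV y hy
      have := h1 y hy
      grind
    · have := h1 a haA
      omega
  refine ⟨?_, ?_⟩
  · intro V hV hVZ x hx
    by_contra hcon
    obtain ⟨y, hy, hyZ⟩ := Finset.not_subset.1 hVZ
    have hxF := h.sub V hV x hx
    have hyF := h.sub V hV y hy
    by_cases hVA : V = A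
    · subst hVA
      exact hcon (hm x hx)
    have hya : y ≠ a := by
      rintro rfl
      exact hVA (huq V hV A hA hy haA)
    exact hVA (h.nc A hA V hV a haA y hy b hbA x hx (by grind) (by grind) (by omega)).symm
  · intro V hV hVZ hbV
    by_contra hne
    exact hVZ (key V hV hne hbV)

lemma nl_split1 {a b : ℕ} {F Y Z : Finset ℕ} (ha : ∀ x ∈ F, a < x) (hb : b ∈ F)
    (hY : ∀ x, x ∈ Y ↔ x ∈ F ∧ b < x) (hZ : ∀ x, x ∈ Z ↔ x ∈ F ∧ b ≤ x)
    {π : Finset (Finset ℕ)} (h : NLp (insert a F) (insert a F) π) (hs : Last a b π) :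
    NLp Y Z (π.filter (· ⊆ Z)) ∧ {b} ∉ π.filter (· ⊆ Z) := by
  obtain ⟨A, hA, haA, hbA, hm⟩ := hs
  have hab := ha b hb
  obtain ⟨d1, d2⟩ := nl_dich ha hb hZ h hA haA hbA hm
  obtain ⟨n, s, c, l, k⟩ := h
  refine ⟨⟨?_, ?_, ?_, ?_, ?_⟩, ?_⟩
  · intro V hV
    exact n V (Finset.mem_filter.1 hV).1
  · intro V hV
    exact (Finset.mem_filter.1 hV).2
  · intro x hx
    obtain ⟨V, hV, hxV⟩ := c x (by grind)
    refine ⟨V, Finset.mem_filter.2 ⟨hV, ?_⟩, hxV⟩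
    by_contra hcon
    have := d1 V hV hcon x hxV
    grind
  · intro V hV W hW
    exact l V (Finset.mem_filter.1 hV).1 W (Finset.mem_filter.1 hW).1
  · intro V hV W hW
    exact k V (Finset.mem_filter.1 hV).1 W (Finset.mem_filter.1 hW).1
  · intro hbb
    have hbπ := (Finset.mem_filter.1 hbb).1
    have hne : ({b} : Finset ℕ) ≠ A := by
      rintro rfl
      simp at haA
      omega
    rcases l {b} hbπ A hA hne b (by simp) hbA with ⟨-, ⟨y, hy, hy'⟩, -⟩ | ⟨h, -, -⟩
    · simp at hy
      omega
    · have := h a haA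
      omega

lemma nl_split2 {a b : ℕ} {F X Z : Finset ℕ} (ha : ∀ x ∈ F, a < x) (hb : b ∈ F)
    (hX : ∀ x, x ∈ X ↔ x = a ∨ (x ∈ F ∧ x < b)) (hZ : ∀ x, x ∈ Z ↔ x ∈ F ∧ b ≤ x)
    {π : Finset (Finset ℕ)} (h : NLp (insert a F) (insert a F) π) (hs : Last a b π) :
    NLp X X ((π.filter (¬ · ⊆ Z)).image (·.erase b)) := by
  obtain ⟨A, hA, haA, hbA, hm⟩ := hs
  have hab := ha b hb
  obtain ⟨d1, d2⟩ := nl_dich ha hb hZ h hA haA hbA hm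
  obtain ⟨n, s, c, l, k⟩ := h
  refine ⟨?_, ?_, ?_, ?_, ?_⟩
  · intro V hV
    simp only [Finset.mem_image, Finset.mem_filter] at hV
    obtain ⟨W, ⟨hW, hWZ⟩, rfl⟩ := hV
    obtain ⟨y, hy, hyZ⟩ := Finset.not_subset.1 hWZ
    exact ⟨y, by grind⟩
  · intro V hV
    simp only [Finset.mem_image, Finset.mem_filter] at hV
    obtain ⟨W, ⟨hW, hWZ⟩, rfl⟩ := hV
    intro x hx
    have := d1 W hW hWZ x (by grind)
    have := s W hW x (by grind)
    grind
  · intro x hx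
    obtain ⟨V, hV, hxV⟩ := c x (by grind)
    refine ⟨V.erase b, Finset.mem_image_of_mem _ (Finset.mem_filter.2 ⟨hV, ?_⟩), by grind⟩
    intro h
    grind
  · intro V hV W hW hne x hx hx'
    simp only [Finset.mem_image, Finset.mem_filter] at hV hW
    obtain ⟨V, ⟨hV, hVZ⟩, rfl⟩ := hV
    obtain ⟨W, ⟨hW, hWZ⟩, rfl⟩ := hW
    have hne' : V ≠ W := by
      rintro rfl
      exact hne rfl
    rw [Finset.mem_erase] at hx hx'
    have key : ∀ V ∈ π, ¬ V ⊆ Z → ∀ W ∈ π, ¬ W ⊆ Z → x ∈ V → x ∈ W → Lk V W x →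
        Lk (V.erase b) (W.erase b) x := by
      intro V hV hVZ W hW hWZ hxV hxW ⟨p, ⟨y, hy, hxy⟩, z, hz, hzx⟩
      have hxb := d1 V hV hVZ x hxV
      have hxs := s W hW z hz
      refine ⟨fun y hy => p y (Finset.mem_of_mem_erase hy), ⟨y, Finset.mem_erase.2 ⟨?_, hy⟩, hxy⟩,
        z, Finset.mem_erase.2 ⟨by omega, hz⟩, hzx⟩
      rintro rfl
      have := d2 V hV hVZ hy
      subst this
      have := p a haA
      grind
    rcases l V hV W hW hne' x hx.2 hx'.2 with h | h
    · exact Or.inl (key V hV hVZ W hW hWZ hx.2 hx'.2 h)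
    · exact Or.inr (key W hW hWZ V hV hVZ hx'.2 hx.2 h)
  · intro V hV W hW
    simp only [Finset.mem_image, Finset.mem_filter] at hV hW
    obtain ⟨V, ⟨hV, hVX⟩, rfl⟩ := hV
    obtain ⟨W, ⟨hW, hWX⟩, rfl⟩ := hW
    intro x hx y hy z hz w hw h1 h2 h3
    rw [k V hV W hW x (Finset.mem_of_mem_erase hx) y (Finset.mem_of_mem_erase hy) z
      (Finset.mem_of_mem_erase hz) w (Finset.mem_of_mem_erase hw) h1 h2 h3]

lemma nl_join_split {a b : ℕ} {F Z : Finset ℕ} (ha : ∀ x ∈ F, a < x) (hb : b ∈ F)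
    (hZ : ∀ x, x ∈ Z ↔ x ∈ F ∧ b ≤ x)
    {π : Finset (Finset ℕ)} (h : NLp (insert a F) (insert a F) π) (hs : Last a b π) :
    ncJoin b a (π.filter (· ⊆ Z)) ((π.filter (¬ · ⊆ Z)).image (·.erase b)) = π := by
  obtain ⟨A, hA, haA, hbA, hm⟩ := hs
  have hab := ha b hb
  obtain ⟨d1, d2⟩ := nl_dich ha hb hZ h hA haA hbA hm
  have huq := h.uniq (a := a) (by grind)
  have haZ : a ∉ Z := by grind
  ext V
  rw [mem_ncJoin]
  simp only [Finset.mem_image, Finset.mem_filter]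
  constructor
  · rintro (⟨h, -⟩ | ⟨C, ⟨D, ⟨hD, -⟩, rfl⟩, haC, rfl⟩ | ⟨⟨D, ⟨hD, hDZ⟩, rfl⟩, haV⟩)
    · exact h
    · have := huq D hD A hA (Finset.mem_of_mem_erase haC) haA
      subst this
      rwa [Finset.insert_erase hbA]
    · by_cases hbD : b ∈ D
      · have := d2 D hD hDZ hbD
        subst this
        exact absurd (Finset.mem_erase.2 ⟨by omega, haA⟩) haV
      · rwa [Finset.erase_eq_of_notMem hbD]
  · intro hV
    by_cases hVZ : V ⊆ Z
    · exact Or.inl ⟨hV, hVZ⟩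
    · by_cases haV : a ∈ V
      · have := huq V hV A hA haV haA
        subst this
        refine Or.inr (Or.inl ⟨_, ⟨V, ⟨hV, hVZ⟩, rfl⟩, Finset.mem_erase.2 ⟨by omega, haA⟩, ?_⟩)
        rw [Finset.insert_erase hbA]
      · refine Or.inr (Or.inr ⟨⟨V, ⟨hV, hVZ⟩, ?_⟩, haV⟩)
        apply Finset.erase_eq_of_notMem
        intro hbV
        have := d2 V hV hVZ hbV
        subst this
        exact haV haA

lemma nl_split_join1 {a b : ℕ} {F X Y Z : Finset ℕ} (ha : ∀ x ∈ F, a < x)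
    (hX : ∀ x, x ∈ X ↔ x = a ∨ (x ∈ F ∧ x < b)) (hZ : ∀ x, x ∈ Z ↔ x ∈ F ∧ b ≤ x)
    {ρ σ : Finset (Finset ℕ)} (h1 : NLp X X ρ) (h2 : NLp Y Z σ) :
    (ncJoin b a σ ρ).filter (· ⊆ Z) = σ := by
  have haZ : a ∉ Z := by grind
  ext V
  rw [Finset.mem_filter, mem_ncJoin]
  constructor
  · rintro ⟨h | ⟨C, hC, hbC, rfl⟩ | ⟨h, hb⟩, hh⟩
    · exact h
    · exact absurd (hh (Finset.mem_insert_of_mem hbC)) haZ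
    · obtain ⟨x, hx⟩ := h1.ne V h
      have := h1.sub V h x hx
      have := hh hx
      grind
  · intro h
    exact ⟨Or.inl h, h2.sub V h⟩

lemma nl_split_join2 {a b : ℕ} {F X Y Z : Finset ℕ} (ha : ∀ x ∈ F, a < x) (hb : b ∈ F)
    (hX : ∀ x, x ∈ X ↔ x = a ∨ (x ∈ F ∧ x < b)) (hZ : ∀ x, x ∈ Z ↔ x ∈ F ∧ b ≤ x)
    {ρ σ : Finset (Finset ℕ)} (h1 : NLp X X ρ) (h2 : NLp Y Z σ) :
    ((ncJoin b a σ ρ).filter (¬ · ⊆ Z)).image (·.erase b) = ρ := by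
  have haZ : a ∉ Z := by grind
  have hab := ha b hb
  have hnot : ∀ C ∈ ρ, b ∉ C := by
    intro C hC hbC
    have := h1.sub C hC b hbC
    grind
  ext V
  simp only [Finset.mem_image, Finset.mem_filter, mem_ncJoin]
  constructor
  · rintro ⟨W, ⟨h | ⟨C, hC, hbC, rfl⟩ | ⟨h, hb⟩, hX⟩, rfl⟩
    · exact absurd (h2.sub W h) hX
    · rwa [Finset.erase_insert (hnot C hC)]
    · rwa [Finset.erase_eq_of_notMem (hnot W h)]
  · intro h
    by_cases haV : a ∈ V
    · refine ⟨insert b V, ⟨Or.inr (Or.inl ⟨V, h, haV, rfl⟩), ?_⟩, Finset.erase_insert (hnot V h)⟩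
      intro hh
      exact haZ (hh (Finset.mem_insert_of_mem haV))
    · refine ⟨V, ⟨Or.inr (Or.inr ⟨h, haV⟩), ?_⟩, Finset.erase_eq_of_notMem (hnot V h)⟩
      intro hh
      obtain ⟨x, hx⟩ := h1.ne V h
      have := h1.sub V h x hx
      have := hh hx
      grind

noncomputable def NLfam (C F : Finset ℕ) : Finset (Finset (Finset ℕ)) :=
  F.powerset.powerset.filter (NLp C F)

lemma mem_NLfam {C F : Finset ℕ} {α : Finset (Finset ℕ)} : α ∈ NLfam C F ↔ NLp C F α := by
  unfold NLfam
  simp only [Finset.mem_filter, Finset.mem_powerset, and_iff_right_iff_imp]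
  intro h V hV
  exact Finset.mem_powerset.2 (h.sub V hV)

section NLsum
variable {R : Type*} [CommRing R]

noncomputable def wtG (t : ℕ → R) (k a : ℕ) (V : Finset ℕ) : R :=
  if a ∈ V then t (V.card - 1 + k) else t (V.card - 1)

noncomputable def sumL (t : ℕ → R) (F : Finset ℕ) : R :=
  ∑ π ∈ NLfam F F, ∏ V ∈ π, t (V.card - 1)

noncomputable def sumG (t : ℕ → R) (k a : ℕ) (F : Finset ℕ) : R :=
  ∑ π ∈ NLfam F F, ∏ V ∈ π, wtG t k a V

noncomputable def sumP (t : ℕ → R) (b : ℕ) (Y Z : Finset ℕ) : R :=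
  ∑ π ∈ (NLfam Y Z).filter ({b} ∉ ·), ∏ V ∈ π, t (V.card - 1)

lemma sumG_zero (t : ℕ → R) (a : ℕ) (F : Finset ℕ) : sumG t 0 a F = sumL t F := by
  simp [sumG, sumL, wtG]

lemma nl_join_prod (t : ℕ → R) (k : ℕ) {a b : ℕ} {F X Y Z : Finset ℕ}
    (ha : ∀ x ∈ F, a < x) (hb : b ∈ F)
    (hX : ∀ x, x ∈ X ↔ x = a ∨ (x ∈ F ∧ x < b)) (hZ : ∀ x, x ∈ Z ↔ x ∈ F ∧ b ≤ x)
    {ρ σ : Finset (Finset ℕ)} (h1 : NLp X X ρ) (h2 : NLp Y Z σ) :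
    ∏ V ∈ ncJoin b a σ ρ, wtG t k a V
      = (∏ V ∈ σ, t (V.card - 1)) * ∏ V ∈ ρ, wtG t (k + 1) a V := by
  have haZ : a ∉ Z := by grind
  have hab := ha b hb
  have hnot : ∀ C ∈ ρ, b ∉ C := by
    intro C hC hbC
    have := h1.sub C hC b hbC
    grind
  rw [ncJoin, Finset.prod_union, Finset.prod_image]
  · congr 1
    · apply Finset.prod_congr rfl
      intro V hV
      have h1 : a ∉ V := fun h => haZ (h2.sub V hV a h)
      simp [wtG, h1]
    · apply Finset.prod_congr rfl
      intro C hC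
      by_cases haC : a ∈ C
      · have : 1 ≤ C.card := Finset.card_pos.2 ⟨a, haC⟩
        simp only [wtG, haC, if_true, Finset.mem_insert_of_mem, Finset.card_insert_of_notMem (hnot C hC)]
        congr 1
        omega
      · simp [wtG, haC]
  · intro C hC D hD h
    simp only at h
    have e : ∀ E : Finset ℕ, b ∉ E → (if a ∈ E then insert b E else E : Finset ℕ).erase b = E := by
      intro E hE
      split_ifs
      · exact Finset.erase_insert hE
      · exact Finset.erase_eq_of_notMem hE
    rw [← e C (hnot C hC), h, e D (hnot D hD)]
  · rw [Finset.disjoint_left]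
    intro V hV hV'
    simp only [Finset.mem_image] at hV'
    obtain ⟨C, hC, rfl⟩ := hV'
    obtain ⟨c, hc⟩ := h1.ne C hC
    have hcY := h1.sub C hC c hc
    have hcX := h2.sub _ hV c (by split_ifs <;> simp [hc])
    grind

lemma nl_last_sum (t : ℕ → R) (k : ℕ) {a b : ℕ} {F : Finset ℕ}
    (ha : ∀ x ∈ F, a < x) (hb : b ∈ F) :
    ∑ π ∈ (NLfam (insert a F) (insert a F)).filter (Last a b), ∏ V ∈ π, wtG t k a V
      = sumP t b (F.filter (b < ·)) (insert b (F.filter (b < ·)))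
        * sumG t (k + 1) a (insert a (F.filter (· < b))) := by
  have hX : ∀ x, x ∈ insert a (F.filter (· < b)) ↔ x = a ∨ (x ∈ F ∧ x < b) := by simp
  have hY : ∀ x, x ∈ F.filter (b < ·) ↔ x ∈ F ∧ b < x := by simp
  have hZ : ∀ x, x ∈ insert b (F.filter (b < ·)) ↔ x ∈ F ∧ b ≤ x := by
    intro x
    simp only [Finset.mem_insert, Finset.mem_filter]
    constructor
    · rintro (rfl | h)
      · exact ⟨hb, le_rfl⟩
      · exact ⟨h.1, h.2.le⟩
    · rintro ⟨h1, h2⟩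
      rcases h2.eq_or_lt with h | h
      · exact Or.inl h.symm
      · exact Or.inr ⟨h1, h⟩
  generalize insert a (F.filter (· < b)) = X at *
  generalize insert b (F.filter (b < ·)) = Z at *
  generalize F.filter (b < ·) = Y at *
  rw [sumP, sumG, Finset.sum_mul_sum, ← Finset.sum_product']
  symm
  refine Finset.sum_bij' (fun p _ => ncJoin b a p.1 p.2)
    (fun π _ => (π.filter (· ⊆ Z), (π.filter (¬ · ⊆ Z)).image (·.erase b))) ?_ ?_ ?_ ?_ ?_
  · rintro ⟨σ, ρ⟩ h
    simp only [Finset.mem_product, Finset.mem_filter, mem_NLfam] at h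
    rw [Finset.mem_filter, mem_NLfam]
    exact ⟨nlJoin_mem ha hb hX hY hZ h.2 h.1.1 h.1.2, nlJoin_last ha hb hX h.2⟩
  · intro π h
    rw [Finset.mem_filter, mem_NLfam] at h
    rw [Finset.mem_product, Finset.mem_filter, mem_NLfam, mem_NLfam]
    exact ⟨nl_split1 ha hb hY hZ h.1 h.2, nl_split2 ha hb hX hZ h.1 h.2⟩
  · rintro ⟨σ, ρ⟩ h
    simp only [Finset.mem_product, Finset.mem_filter, mem_NLfam] at h
    exact Prod.ext (nl_split_join1 ha hX hZ h.2 h.1.1) (nl_split_join2 ha hb hX hZ h.2 h.1.1)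
  · intro π h
    rw [Finset.mem_filter, mem_NLfam] at h
    exact nl_join_split ha hb hZ h.1 h.2
  · rintro ⟨σ, ρ⟩ h
    simp only [Finset.mem_product, Finset.mem_filter, mem_NLfam] at h
    exact (nl_join_prod t k ha hb hX hZ h.2 h.1.1).symm

lemma nl_single_sum (t : ℕ → R) (k : ℕ) {a : ℕ} {F : Finset ℕ}
    (ha : ∀ x ∈ F, a < x) :
    ∑ α ∈ (NLfam (insert a F) (insert a F)).filter ({a} ∈ ·), ∏ V ∈ α, wtG t k a V
      = t k * sumL t F := by
  rw [sumL, Finset.mul_sum]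
  symm
  have hnot' : ∀ α ∈ NLfam F F, ∀ V ∈ α, a ∉ V := by
    intro α h V hV haV
    rw [mem_NLfam] at h
    have := ha a (h.sub _ hV a haV)
    omega
  have hnot : ∀ α ∈ NLfam F F, {a} ∉ α := by
    intro α h h'
    exact hnot' α h _ h' (by simp)
  refine Finset.sum_bij' (fun α _ => insert {a} α) (fun α _ => α.erase {a}) ?_ ?_ ?_ ?_ ?_
  · intro α h
    have hn := hnot' α h
    rw [mem_NLfam] at h
    rw [Finset.mem_filter, mem_NLfam]
    refine ⟨?_, by simp⟩
    obtain ⟨n, s, c, l, k⟩ := h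
    refine ⟨?_, by grind, ?_, ?_, ?_⟩
    · intro V hV
      rw [Finset.mem_insert] at hV
      rcases hV with rfl | hV
      · exact ⟨a, by simp⟩
      · exact n V hV
    · intro x hx
      by_cases h : x = a
      · exact ⟨{a}, by simp, by simp [h]⟩
      · obtain ⟨V, hV, hxV⟩ := c x (by grind)
        exact ⟨V, by grind⟩
    · intro V hV W hW hne x hxV hxW
      rw [Finset.mem_insert] at hV hW
      rcases hV with rfl | hV <;> rcases hW with rfl | hW
      · exact absurd rfl hne
      · rw [Finset.mem_singleton] at hxV
        subst hxV
        exact absurd hxW (hn W hW)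
      · rw [Finset.mem_singleton] at hxW
        subst hxW
        exact absurd hxV (hn V hV)
      · exact l V hV W hW hne x hxV hxW
    · intro V hV W hW x hx y hy z hz w hw hxy hyz hzw
      rw [Finset.mem_insert] at hV hW
      rcases hV with rfl | hV
      · simp at hx hz
        omega
      rcases hW with rfl | hW
      · simp at hy hw
        omega
      exact k V hV W hW x hx y hy z hz w hw hxy hyz hzw
  · intro α h
    rw [Finset.mem_filter, mem_NLfam] at h
    rw [mem_NLfam]
    obtain ⟨h, h0⟩ := h
    have huq := h.uniq (a := a) (by grind)
    obtain ⟨n, s, c, l, k⟩ := h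
    have key : ∀ V ∈ α, V ≠ {a} → a ∉ V := by
      intro V hV hne haV
      exact hne (huq V hV {a} h0 haV (by simp))
    refine ⟨?_, ?_, ?_, ?_, ?_⟩
    · intro V hV
      exact n V (Finset.mem_of_mem_erase hV)
    · intro V hV x hx
      rw [Finset.mem_erase] at hV
      have h1 := s V hV.2 x hx
      have h2 := key V hV.2 hV.1
      rw [Finset.mem_insert] at h1
      rcases h1 with rfl | h1
      · exact absurd hx h2
      · exact h1
    · intro x hx
      obtain ⟨V, hV, hxV⟩ := c x (by grind)
      refine ⟨V, ?_, hxV⟩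
      rw [Finset.mem_erase]
      refine ⟨?_, hV⟩
      rintro rfl
      have := ha x hx
      simp at hxV
      omega
    · intro V hV W hW
      exact l V (Finset.mem_of_mem_erase hV) W (Finset.mem_of_mem_erase hW)
    · intro V hV W hW
      exact k V (Finset.mem_of_mem_erase hV) W (Finset.mem_of_mem_erase hW)
  · intro α h
    exact Finset.erase_insert (hnot α h)
  · intro α h
    exact Finset.insert_erase (Finset.mem_filter.1 h).2
  · intro α h
    rw [Finset.prod_insert (hnot α h)]
    congr 1
    · simp [wtG]
    · apply Finset.prod_congr rfl
      intro V hV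
      simp [wtG, hnot' α h V hV]

lemma nl_rec (t : ℕ → R) (k : ℕ) {a : ℕ} {F : Finset ℕ} (ha : ∀ x ∈ F, a < x) :
    sumG t k a (insert a F) = t k * sumL t F
      + ∑ b ∈ F, sumP t b (F.filter (b < ·)) (insert b (F.filter (b < ·)))
        * sumG t (k + 1) a (insert a (F.filter (· < b))) := by
  rw [← nl_single_sum t k ha, ← Finset.sum_congr rfl (fun b hb => nl_last_sum t k ha hb),
    ← Finset.sum_biUnion, sumG, ← Finset.sum_filter_add_sum_filter_not _ ({a} ∈ ·)]
  · congr 1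
    apply Finset.sum_congr _ (fun _ _ => rfl)
    ext α
    simp only [Finset.mem_filter, mem_NLfam, Finset.mem_biUnion]
    constructor
    · rintro ⟨h, h0⟩
      obtain ⟨A, hA, haA⟩ := h.cov a (by simp)
      have hmem := Finset.max'_mem A ⟨a, haA⟩
      have hle := fun x hx => Finset.le_max' A x hx
      refine ⟨A.max' ⟨a, haA⟩, ?_, h, A, hA, haA, hmem, hle⟩
      have h1 := h.sub A hA _ hmem
      rw [Finset.mem_insert] at h1
      rcases h1 with h1 | h1
      · exfalso
        apply h0
        have : A = {a} := by
          ext x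
          rw [Finset.mem_singleton]
          constructor
          · intro hx
            have h2 := hle x hx
            have h3 := h.sub A hA x hx
            rw [Finset.mem_insert] at h3
            rcases h3 with h3 | h3
            · exact h3
            · have := ha x h3
              omega
          · rintro rfl
            exact haA
        rwa [← this]
      · exact h1
    · rintro ⟨b, hb, h, A, hA, haA, hbA, hm⟩
      refine ⟨h, fun h0 => ?_⟩
      have := h.uniq (a := a) (by grind) A hA {a} h0 haA (by simp)
      subst this
      have := ha b hb
      simp at hbA
      omega
  · intro b hb c hc hbc
    rw [Function.onFun, Finset.disjoint_left]
    intro α h1 h2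
    simp only [Finset.mem_filter, mem_NLfam] at h1 h2
    obtain ⟨h, A, hA, haA, hbA, hm⟩ := h1
    obtain ⟨-, B, hB, haB, hcB, hm'⟩ := h2
    have := h.uniq (a := a) (by grind) A hA B hB haA haB
    subst this
    have h5 := hm c hcB
    have h6 := hm' b hbA
    omega

lemma sumP_eq (t : ℕ → R) {b : ℕ} {Y : Finset ℕ} (hb : ∀ x ∈ Y, b < x) :
    sumP t b Y (insert b Y) = sumL t Y + sumL t (insert b Y) - t 0 * sumL t Y := by
  have h1 := nl_single_sum t 0 hb
  have h2 : sumL t (insert b Y) = t 0 * sumL t Y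
      + ∑ π ∈ (NLfam (insert b Y) (insert b Y)).filter ({b} ∉ ·), ∏ V ∈ π, t (V.card - 1) := by
    rw [← h1, sumL, ← Finset.sum_filter_add_sum_filter_not _ ({b} ∈ ·)]
    simp [wtG]
  rw [h2, sumP, sumL, ← Finset.sum_filter_add_sum_filter_not _ (fun π => ∀ V ∈ π, b ∉ V)]
  have e1 : ((NLfam Y (insert b Y)).filter ({b} ∉ ·)).filter (fun π => ∀ V ∈ π, b ∉ V)
      = NLfam Y Y := by
    ext π
    simp only [Finset.mem_filter, mem_NLfam]
    constructor
    · rintro ⟨⟨h, -⟩, h0⟩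
      refine ⟨h.ne, ?_, h.cov, h.lk, h.nc⟩
      intro V hV x hx
      have h1 := h.sub V hV x hx
      rw [Finset.mem_insert] at h1
      rcases h1 with rfl | h1
      · exact absurd hx (h0 V hV)
      · exact h1
    · intro h
      have h0 : ∀ V ∈ π, b ∉ V := by
        intro V hV hbV
        have := hb b (h.sub V hV b hbV)
        omega
      exact ⟨⟨⟨h.ne, fun V hV x hx => Finset.mem_insert_of_mem (h.sub V hV x hx), h.cov, h.lk,
        h.nc⟩, fun h' => h0 _ h' (by simp)⟩, h0⟩
  have e2 : ((NLfam Y (insert b Y)).filter ({b} ∉ ·)).filter (fun π => ¬ ∀ V ∈ π, b ∉ V)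
      = (NLfam (insert b Y) (insert b Y)).filter ({b} ∉ ·) := by
    ext π
    simp only [Finset.mem_filter, mem_NLfam]
    constructor
    · rintro ⟨⟨h, h'⟩, h0⟩
      refine ⟨⟨h.ne, h.sub, ?_, h.lk, h.nc⟩, h'⟩
      intro x hx
      rw [Finset.mem_insert] at hx
      rcases hx with rfl | hx
      · push Not at h0
        exact h0
      · exact h.cov x hx
    · rintro ⟨h, h'⟩
      refine ⟨⟨⟨h.ne, h.sub, fun x hx => h.cov x (Finset.mem_insert_of_mem hx), h.lk, h.nc⟩, h'⟩, ?_⟩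
      obtain ⟨V, hV, hbV⟩ := h.cov b (by simp)
      exact fun hc => hc V hV hbV
  rw [e1, e2]
  ring
end NLsum

section fin
variable {R : Type*} [CommRing R]

lemma sumH_zero (s u : ℕ → R) {a : ℕ} {F : Finset ℕ} (ha : ∀ x ∈ F, a ≤ x) :
    sumH s u 0 a F = sumM s u F := by
  unfold sumH sumM
  refine Finset.sum_congr rfl fun α hα => Finset.prod_congr rfl fun V hV => ?_
  rw [mem_NCfam] at hα
  unfold wtH
  split_ifs with h
  · unfold wtM
    rw [if_neg]
    · rfl
    · rintro ⟨W, hW, x, hx, y, hy, hxy⟩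
      have := ha x (hα.sub W hW x hx)
      have := hxy a h
      omega
  · rfl

lemma sumM_empty (s u : ℕ → R) : sumM s u ∅ = 1 := by
  have : NCfam ∅ = {∅} := by
    ext α
    rw [mem_NCfam, Finset.mem_singleton]
    constructor
    · intro h
      rw [Finset.eq_empty_iff_forall_notMem]
      intro V hV
      obtain ⟨x, hx⟩ := h.ne V hV
      simpa using h.sub V hV x hx
    · rintro rfl
      constructor <;> simp [Cov, Ncr]
  simp [sumM, this]

lemma sumL_empty (t : ℕ → R) : sumL t ∅ = 1 := by
  have : NLfam ∅ ∅ = {∅} := by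
    ext α
    rw [mem_NLfam, Finset.mem_singleton]
    constructor
    · intro h
      rw [Finset.eq_empty_iff_forall_notMem]
      intro V hV
      obtain ⟨x, hx⟩ := h.ne V hV
      simpa using h.sub V hV x hx
    · rintro rfl
      constructor <;> simp [Cov, Ncr]
  simp [sumL, this]

lemma rank_sum (φ : ℕ → R) (F : Finset ℕ) :
    ∑ b ∈ F, φ (F.filter (· < b)).card = ∑ i ∈ Finset.range F.card, φ i := by
  induction F using Finset.induction_on_max with
  | empty => simp
  | insert M F hM ih =>
    have hn : M ∉ F := fun h => lt_irrefl _ (hM M h)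
    rw [Finset.sum_insert hn, Finset.card_insert_of_notMem hn, Finset.sum_range_succ, ← ih,
      add_comm]
    congr 1
    · refine Finset.sum_congr rfl fun b hb => ?_
      congr 2
      ext x
      have := hM b hb
      grind
    · congr 2
      ext x
      grind

lemma card_ge (F : Finset ℕ) (b : ℕ) :
    (F.filter (· < b)).card + (F.filter (b ≤ ·)).card = F.card := by
  rw [← Finset.card_filter_add_card_filter_not (s := F) (· < b)]
  simp

lemma card_gt {F : Finset ℕ} {b : ℕ} (hb : b ∈ F) :
    (F.filter (· < b)).card + (F.filter (b < ·)).card + 1 = F.card := by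
  rw [← card_ge F b]
  have : F.filter (b ≤ ·) = insert b (F.filter (b < ·)) := by
    ext x
    grind
  rw [this, Finset.card_insert_of_notMem (by simp)]
  omega

lemma ex_min {F : Finset ℕ} {m : ℕ} (h : F.card = m + 1) :
    ∃ a G, (∀ x ∈ G, a < x) ∧ F = insert a G ∧ G.card = m := by
  have hne : F.Nonempty := by
    rw [← Finset.card_pos]
    omega
  refine ⟨F.min' hne, F.erase (F.min' hne), ?_, ?_, ?_⟩
  · intro x hx
    exact Finset.min'_lt_of_mem_erase_min' _ _ hx
  · rw [Finset.insert_erase (Finset.min'_mem _ _)]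
  · rw [Finset.card_erase_of_mem (Finset.min'_mem _ _), h]
    rfl

noncomputable def lseq (t : ℕ → R) (f : ℕ) : R := sumL t (Finset.Icc 1 f)
noncomputable def gseq (t : ℕ → R) (k f : ℕ) : R := sumG t k 0 (insert 0 (Finset.Icc 1 f))
noncomputable def mseq (s u : ℕ → R) (f : ℕ) : R := sumM s u (Finset.Icc 1 f)
noncomputable def hseq (s u : ℕ → R) (k f : ℕ) : R := sumH s u k 0 (insert 0 (Finset.Icc 1 f))

def LGat (t : ℕ → R) (f : ℕ) : Prop :=
  (∀ F : Finset ℕ, F.card = f → sumL t F = lseq t f) ∧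
    ∀ k a (F : Finset ℕ), F.card = f → (∀ x ∈ F, a < x) → sumG t k a (insert a F) = gseq t k f

lemma l_step (t : ℕ → R) (f : ℕ) (ih : ∀ m < f, LGat t m) :
    ∀ F : Finset ℕ, F.card = f → sumL t F = lseq t f := by
  rcases f with _ | m
  · intro F hF
    rw [Finset.card_eq_zero] at hF
    subst hF
    simp [lseq]
  · have key : ∀ F : Finset ℕ, F.card = m + 1 → sumL t F = gseq t 0 m := by
      intro F hF
      obtain ⟨a, G, h1, rfl, h3⟩ := ex_min hF
      rw [← sumG_zero t a]
      exact (ih m (by omega)).2 0 a G h3 h1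
    intro F hF
    rw [key F hF, lseq, key _ (by simp)]

lemma g_step (t : ℕ → R) (f : ℕ) (ih : ∀ m < f, LGat t m)
    (hl : ∀ F : Finset ℕ, F.card = f → sumL t F = lseq t f) (k a : ℕ) (F : Finset ℕ)
    (hF : F.card = f) (ha : ∀ x ∈ F, a < x) :
    sumG t k a (insert a F) = t k * lseq t f + ∑ i ∈ Finset.range f,
      (lseq t (f - 1 - i) + lseq t (f - 1 - i + 1) - t 0 * lseq t (f - 1 - i))
        * gseq t (k + 1) i := by
  rw [nl_rec t k ha, hl F hF, ← hF, ← rank_sum]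
  congr 1
  refine Finset.sum_congr rfl fun b hb => ?_
  have hc := card_gt hb
  have hl2 : ∀ F : Finset ℕ, F.card ≤ f → sumL t F = lseq t F.card := by
    intro F hF
    rcases hF.lt_or_eq with h | h
    · exact (ih _ h).1 F rfl
    · rw [h]
      exact hl F h
  have e : F.card - 1 - (F.filter (· < b)).card = (F.filter (b < ·)).card := by omega
  rw [sumP_eq t (by simp), e, hl2 _ (by omega)]
  rw [hl2 (insert b _) (by rw [Finset.card_insert_of_notMem (by simp)]; omega)]
  rw [Finset.card_insert_of_notMem (by simp)]
  rw [(ih (F.filter (· < b)).card (by omega)).2 _ a _ rfl]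
  intro x hx
  exact ha x (Finset.mem_of_mem_filter x hx)

lemma lg_all (t : ℕ → R) (f : ℕ) : LGat t f := by
  induction f using Nat.strong_induction_on with
  | _ f ih =>
    have hl := l_step t f ih
    refine ⟨hl, ?_⟩
    intro k a F hF ha
    rw [g_step t f ih hl k a F hF ha, gseq, g_step t f ih hl k 0 _ (by simp)]
    intro x hx
    rw [Finset.mem_Icc] at hx
    omega

lemma gseq_rec (t : ℕ → R) (k f : ℕ) : gseq t k f = t k * lseq t f + ∑ i ∈ Finset.range f,
      (lseq t (f - 1 - i) + lseq t (f - 1 - i + 1) - t 0 * lseq t (f - 1 - i))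
        * gseq t (k + 1) i := by
  refine g_step t f (fun m _ => lg_all t m) (lg_all t f).1 k 0 _ (by simp) ?_
  intro x hx
  rw [Finset.mem_Icc] at hx
  omega

lemma insert_zero_Icc (f : ℕ) : (insert 0 (Finset.Icc 1 f)).card = f + 1 := by
  rw [Finset.card_insert_of_notMem (by simp)]
  simp

lemma lseq_succ (t : ℕ → R) (f : ℕ) : lseq t (f + 1) = gseq t 0 f := by
  rw [gseq, sumG_zero, ← (lg_all t (f + 1)).1 _ (insert_zero_Icc f)]

lemma lseq_zero (t : ℕ → R) : lseq t 0 = 1 := by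
  simp [lseq, sumL_empty]

def MHat (u : ℕ → R) (f : ℕ) : Prop := ∀ s : ℕ → R,
  (∀ F : Finset ℕ, F.card = f → sumM s u F = mseq s u f) ∧
    ∀ k a (F : Finset ℕ), F.card = f → (∀ x ∈ F, a < x) →
      sumH s u k a (insert a F) = hseq s u k f

lemma m_step (s u : ℕ → R) (f : ℕ) (ih : ∀ m < f, MHat u m) :
    ∀ F : Finset ℕ, F.card = f → sumM s u F = mseq s u f := by
  rcases f with _ | m
  · intro F hF
    rw [Finset.card_eq_zero] at hF
    subst hF
    simp [mseq]
  · have key : ∀ F : Finset ℕ, F.card = m + 1 → sumM s u F = hseq s u 0 m := by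
      intro F hF
      obtain ⟨a, G, h1, rfl, h3⟩ := ex_min hF
      rw [← sumH_zero s u (a := a)]
      · exact (ih m (by omega) s).2 0 a G h3 h1
      · intro x hx
        rw [Finset.mem_insert] at hx
        rcases hx with rfl | hx
        · exact le_rfl
        · exact (h1 x hx).le
    intro F hF
    rw [key F hF, mseq, key _ (by simp)]

lemma h_step (s u : ℕ → R) (f : ℕ) (ih : ∀ m < f, MHat u m)
    (hl : ∀ F : Finset ℕ, F.card = f → sumM s u F = mseq s u f) (k a : ℕ) (F : Finset ℕ)
    (hF : F.card = f) (ha : ∀ x ∈ F, a < x) :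
    sumH s u k a (insert a F) = s k * mseq s u f + ∑ i ∈ Finset.range f,
      mseq u u i * hseq s u (k + 1) (f - 1 - i) := by
  rw [nc_rec s u k ha, hl F hF, ← hF, ← rank_sum]
  congr 1
  refine Finset.sum_congr rfl fun b hb => ?_
  have hc := card_gt hb
  have e : F.card - 1 - (F.filter (· < b)).card = (F.filter (b < ·)).card := by omega
  have e2 : F.filter (b ≤ ·) = insert b (F.filter (b < ·)) := by
    ext x
    grind
  rw [e, e2, (ih (F.filter (· < b)).card (by omega) u).1 _ rfl,
    (ih (F.filter (b < ·)).card (by omega) s).2 _ b _ rfl (by simp)]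

lemma mh_all (u : ℕ → R) (f : ℕ) : MHat u f := by
  induction f using Nat.strong_induction_on with
  | _ f ih =>
    intro s
    have hl := m_step s u f ih
    refine ⟨hl, ?_⟩
    intro k a F hF ha
    rw [h_step s u f ih hl k a F hF ha, hseq, h_step s u f ih hl k 0 _ (by simp)]
    intro x hx
    rw [Finset.mem_Icc] at hx
    omega

lemma hseq_rec (s u : ℕ → R) (k f : ℕ) : hseq s u k f = s k * mseq s u f +
    ∑ i ∈ Finset.range f, mseq u u i * hseq s u (k + 1) (f - 1 - i) := by
  refine h_step s u f (fun m _ => mh_all u m) (mh_all u f s).1 k 0 _ (by simp) ?_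
  intro x hx
  rw [Finset.mem_Icc] at hx
  omega

lemma mseq_succ (s u : ℕ → R) (f : ℕ) : mseq s u (f + 1) = hseq s u 0 f := by
  rw [hseq, sumH_zero _ _ (by simp), ← (mh_all u (f + 1) s).1 _ (insert_zero_Icc f)]

lemma mseq_zero (s u : ℕ → R) : mseq s u 0 = 1 := by
  simp [mseq, sumM_empty]

open PowerSeries in
lemma ps_conv (c : R) (l p q : ℕ → R) (g : ℕ → R)
    (h : ∀ f, g f = c * l f + ∑ i ∈ Finset.range f, p i * q (f - 1 - i)) :
    PowerSeries.mk g = C c * PowerSeries.mk l + X * (PowerSeries.mk p * PowerSeries.mk q) := by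
  ext f
  rw [map_add, coeff_C_mul, coeff_mk, coeff_mk, h f]
  congr 1
  rcases f with _ | f
  · simp
  · rw [coeff_succ_X_mul, coeff_mul,
      Finset.Nat.sum_antidiagonal_eq_sum_range_succ_mk]
    simp

open PowerSeries in
lemma eq_zero_of_X_pow {D : PowerSeries R} (h : ∀ j, X ^ j ∣ D) : D = 0 := by
  ext j
  have := X_pow_dvd_iff.mp (h (j + 1)) j (by omega)
  simpa using this

open PowerSeries in
lemma ps_succ (l g : ℕ → R) (h0 : l 0 = 1) (h : ∀ f, l (f + 1) = g f) :
    PowerSeries.mk l = 1 + X * PowerSeries.mk g := by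
  ext f
  rcases f with _ | f
  · simp [h0]
  · simp [h, coeff_succ_X_mul, coeff_one]

open PowerSeries in
lemma lseq_eq_mseq (t : ℕ → R) :
    lseq t = mseq t (fun j => t j + t (j + 1)) := by
  set u : ℕ → R := fun j => t j + t (j + 1) with hu
  let L : PowerSeries R := PowerSeries.mk (lseq t)
  let M : PowerSeries R := PowerSeries.mk (mseq t u)
  let N : PowerSeries R := PowerSeries.mk (mseq u u)
  let G : ℕ → PowerSeries R := fun k => X * PowerSeries.mk (gseq t k)
  let H : ℕ → PowerSeries R := fun k => X * PowerSeries.mk (hseq t u k)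
  let V : ℕ → PowerSeries R := fun k => X * PowerSeries.mk (hseq u u k)
  let pf : ℕ → R := fun j => lseq t j + lseq t (j + 1) - t 0 * lseq t j
  let P : PowerSeries R := X * PowerSeries.mk pf
  have hL : L = 1 + G 0 := ps_succ _ _ (lseq_zero t) (lseq_succ t)
  have hM : M = 1 + H 0 := ps_succ _ _ (mseq_zero t u) (mseq_succ t u)
  have hN : N = 1 + V 0 := ps_succ _ _ (mseq_zero u u) (mseq_succ u u)
  have hP : P = (L - 1) + (1 - C (t 0)) * X * L := by
    have e1 : PowerSeries.mk pf = L + PowerSeries.mk (gseq t 0) - C (t 0) * L := by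
      ext f
      simp [pf, L, lseq_succ]
    have e2 : L - 1 = X * PowerSeries.mk (gseq t 0) := by
      rw [hL]
      ring
    simp only [P, e1, e2]
    ring
  have rG : ∀ k, G k = X * C (t k) * L + G (k + 1) * P := by
    intro k
    have := ps_conv (t k) (lseq t) (gseq t (k + 1)) pf (gseq t k) (by
      intro f
      rw [gseq_rec]
      congr 1
      exact Finset.sum_congr rfl fun i _ => mul_comm _ _)
    simp only [G, P, this, L]
    ring
  have rH : ∀ k, H k = X * C (t k) * M + X * N * H (k + 1) := by
    intro k
    have := ps_conv (t k) (mseq t u) (mseq u u) (hseq t u (k + 1)) (hseq t u k)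
      (hseq_rec t u k)
    simp only [H, M, N, this]
    ring
  have rV : ∀ k, V k = X * (C (t k) + C (t (k + 1))) * N + X * N * V (k + 1) := by
    intro k
    have := ps_conv (u k) (mseq u u) (mseq u u) (hseq u u (k + 1)) (hseq u u k)
      (hseq_rec u u k)
    rw [show u k = t k + t (k + 1) from rfl, map_add] at this
    simp only [V, N, this]
    ring
  have XH : ∀ k, X ∣ H k := fun k => Dvd.intro _ rfl
  have XP : X ∣ P := Dvd.intro _ rfl
  have dL : L = PowerSeries.mk (lseq t) := rfl
  have dM : M = PowerSeries.mk (mseq t u) := rfl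
  clear_value L M N G H V P
  -- first relation
  have hD : ∀ j k, X ^ j ∣ V k * M - N * (H k + H (k + 1)) := by
    intro j
    induction j with
    | zero => simp
    | succ j ih =>
      intro k
      obtain ⟨c, hc⟩ := ih (k + 1)
      refine ⟨N * c, ?_⟩
      have e : V k * M - N * (H k + H (k + 1))
          = X * N * (V (k + 1) * M - N * (H (k + 1) + H (k + 2))) := by
        linear_combination M * rV k - N * rH k - N * rH (k + 1)
      rw [e]
      rw [show k + 1 + 1 = k + 2 from rfl] at hc
      rw [hc]
      ring
  have hD0 := eq_zero_of_X_pow fun j => hD j 0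
  have hN2 : N = M + N * H 1 := by
    linear_combination hD0 + M * hN - N * hM
  have hQ : X * N = (M - 1) + (1 - C (t 0)) * X * M := by
    have := rH 0
    rw [zero_add] at this
    linear_combination X * hN2 - this - hM
  have rE : ∀ k, G k - H k = X * C (t k) * (G 0 - H 0) + (G (k + 1) - H (k + 1)) * P
      + H (k + 1) * ((G 0 - H 0) * (1 + (1 - C (t 0)) * X)) := by
    intro k
    linear_combination rG k - rH k + X * C (t k) * (hL - hM)
      + H (k + 1) * (hP - hQ) + H (k + 1) * (1 + (1 - C (t 0)) * X) * (hL - hM)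
  have hE : ∀ j k, X ^ j ∣ G k - H k := by
    intro j
    induction j with
    | zero => simp
    | succ j ih =>
      intro k
      rw [rE k, pow_succ']
      obtain ⟨c, hc⟩ := ih 0
      obtain ⟨d, hd⟩ := ih (k + 1)
      obtain ⟨p, hp⟩ := XP
      obtain ⟨h, hh⟩ := XH (k + 1)
      rw [hd, hp, hh, hc]
      exact ⟨C (t k) * c + d * p + h * c * (1 + (1 - C (t 0)) * X), by ring⟩
  have hE0 := eq_zero_of_X_pow fun j => hE j 0
  have hLM : L = M := by linear_combination hL - hM + hE0
  rw [dL, dM] at hLM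
  funext f
  have := congrArg (coeff f) hLM
  simpa using this

lemma sumL_eq_sumM (t : ℕ → R) (F : Finset ℕ) :
    sumL t F = sumM t (fun j => t j + t (j + 1)) F := by
  rw [(lg_all t F.card).1 F rfl, (mh_all _ F.card t).1 F rfl, lseq_eq_mseq]

end fin

lemma fmin_mem {A : Finset ℕ} (h : ∃ x, x ∈ A) : fmin A ∈ A := by
  have : (A : Set ℕ).Nonempty := h
  exact_mod_cast Nat.sInf_mem this

lemma fmin_le {A : Finset ℕ} {x : ℕ} (h : x ∈ A) : fmin A ≤ x :=
  Nat.sInf_le (by exact_mod_cast h)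

lemma fmax_mem {A : Finset ℕ} (h : ∃ x, x ∈ A) : fmax A ∈ A := by
  have h1 : (A : Set ℕ).Nonempty := h
  exact_mod_cast Nat.sSup_mem h1 A.bddAbove

lemma le_fmax {A : Finset ℕ} {x : ℕ} (h : x ∈ A) : x ≤ fmax A :=
  le_csSup A.bddAbove (by exact_mod_cast h)

lemma ncr_iff (α : Finset (Finset ℕ)) : ¬ IsCrossing α ↔ Ncr α := by
  constructor
  · intro h A hA B hB a ha b hb c hc d hd h1 h2 h3
    by_contra hne
    exact h ⟨A, hA, B, hB, hne, a, ha, b, hb, c, hc, d, hd, h1, h2, h3⟩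
  · rintro h ⟨A, hA, B, hB, hne, a, ha, b, hb, c, hc, d, hd, h1, h2, h3⟩
    exact hne (h A hA B hB a ha b hb c hc d hd h1 h2 h3)

lemma NCF_eq (n : ℕ) : NCF n = NCfam (Finset.Icc 1 n) := by
  unfold NCF NCfam
  refine Finset.filter_congr fun α _ => ?_
  unfold IsNCPartition IsPartitionOf IsPartitionOfSet
  rw [ncr_iff]
  constructor
  · rintro ⟨⟨h1, h2, h3, h4⟩, h5⟩
    refine ⟨h1, fun V hV x hx => h2 V hV hx, h3, ?_, h5⟩
    intro V hV W hW x hxV hxW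
    by_contra hne
    have := h4 V hV W hW hne
    have hx : x ∈ V ∩ W := Finset.mem_inter.mpr ⟨hxV, hxW⟩
    rw [this] at hx
    simp at hx
  · rintro ⟨h1, h2, h3, h4, h5⟩
    refine ⟨⟨h1, fun V hV x hx => h2 V hV x hx, h3, ?_⟩, h5⟩
    intro V hV W hW hne
    rw [Finset.eq_empty_iff_forall_notMem]
    intro x hx
    rw [Finset.mem_inter] at hx
    exact hne (h4 V hV W hW x hx.1 hx.2)

lemma two_le_of {A : Finset ℕ} {x y : ℕ} (hx : x ∈ A) (hy : y ∈ A) (h : x < y) : 2 ≤ A.card :=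
  Finset.one_lt_card.mpr ⟨x, hx, y, hy, h.ne⟩

lemma exists_gt_fmin {A : Finset ℕ} (h : 2 ≤ A.card) : ∃ y ∈ A, fmin A < y := by
  obtain ⟨y, hy, hne⟩ := Finset.exists_mem_ne (s := A) (by omega) (fmin A)
  exact ⟨y, hy, lt_of_le_of_ne (fmin_le hy) (Ne.symm hne)⟩

/-- the linking condition, from the elementwise one, one orientation -/
lemma lk_fmin {A B : Finset ℕ} {x : ℕ} (hA : x ∈ A) (h : Lk A B x) :
    x = fmin A ∧ fmin B < x := by
  obtain ⟨h1, _, z, hz, hzx⟩ := h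
  exact ⟨le_antisymm (h1 _ (fmin_mem ⟨x, hA⟩)) (fmin_le hA), (fmin_le hz).trans_lt hzx⟩

lemma link_iff {A B : Finset ℕ} :
    (A ∩ B = ∅ ∨
        (2 ≤ A.card ∧ 2 ≤ B.card ∧ (A ∩ B).card = 1 ∧ fmin A ≠ fmin B ∧
          ∀ x ∈ A ∩ B, x = fmin A ∨ x = fmin B)) ↔
      ∀ x ∈ A, x ∈ B → Lk A B x ∨ Lk B A x := by
  constructor
  · rintro (h | ⟨h1, h2, h3, h4, h5⟩) x hA hB
    · have hx : x ∈ A ∩ B := Finset.mem_inter.mpr ⟨hA, hB⟩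
      rw [h] at hx
      simp at hx
    · have hA' := fmin_le hA
      have hB' := fmin_le hB
      rcases h5 x (Finset.mem_inter.mpr ⟨hA, hB⟩) with h | h
      · refine Or.inl ⟨fun y hy => h ▸ fmin_le hy, h ▸ exists_gt_fmin h1,
          fmin B, fmin_mem ⟨x, hB⟩, ?_⟩
        omega
      · refine Or.inr ⟨fun y hy => h ▸ fmin_le hy, h ▸ exists_gt_fmin h2,
          fmin A, fmin_mem ⟨x, hA⟩, ?_⟩
        omega
  · intro h
    by_cases he : A ∩ B = ∅
    · exact Or.inl he
    right
    obtain ⟨x, hx⟩ := Finset.nonempty_iff_ne_empty.mpr he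
    have key : ∀ y ∈ A ∩ B, (y = fmin A ∧ fmin B < y) ∨ (y = fmin B ∧ fmin A < y) := by
      intro y hy
      rw [Finset.mem_inter] at hy
      rcases h y hy.1 hy.2 with h | h
      · exact Or.inl (lk_fmin hy.1 h)
      · exact Or.inr (lk_fmin hy.2 h)
    have kx := key x hx
    have hx' := Finset.mem_inter.mp hx
    have h12 : 2 ≤ A.card ∧ 2 ≤ B.card := by
      rcases h x hx'.1 hx'.2 with ⟨_, ⟨y, hy, hxy⟩, z, hz, hzx⟩ | ⟨_, ⟨y, hy, hxy⟩, z, hz, hzx⟩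
      · exact ⟨two_le_of hx'.1 hy hxy, two_le_of hz hx'.2 hzx⟩
      · exact ⟨two_le_of hz hx'.1 hzx, two_le_of hx'.2 hy hxy⟩
    refine ⟨h12.1, h12.2, ?_, by omega, fun y hy => ?_⟩
    · rw [Finset.card_eq_one]
      refine ⟨x, Finset.eq_singleton_iff_unique_mem.mpr ⟨hx, fun y hy => ?_⟩⟩
      have ky := key y hy
      omega
    · have ky := key y hy
      omega

lemma NCLF_eq (n : ℕ) : NCLF n = NLfam (Finset.Icc 1 n) (Finset.Icc 1 n) := by
  unfold NCLF NLfam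
  refine Finset.filter_congr fun α _ => ?_
  unfold IsNCL IsNCLOfSet IsLinkedPartitionOfSet
  rw [ncr_iff]
  simp only [link_iff]
  constructor
  · rintro ⟨⟨h1, h2, h3, h4⟩, h5⟩
    exact ⟨h1, fun V hV x hx => h2 V hV hx, h3, h4, h5⟩
  · rintro ⟨h1, h2, h3, h4, h5⟩
    exact ⟨⟨h1, fun V hV x hx => h2 V hV x hx, h3, h4⟩, h5⟩

lemma outer_iff {α : Finset (Finset ℕ)} (hne : ∀ V ∈ α, ∃ x, x ∈ V) {V : Finset ℕ}
    (hV : V ∈ α) : Inn α V ↔ ¬ OuterBlock α V := by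
  unfold OuterBlock Inn
  push Not
  constructor
  · rintro ⟨W, hW, x, hx, y, hy, h⟩
    exact ⟨W, hW, (fmin_le hx).trans_lt (h _ (fmin_mem (hne V hV))).1,
      (h _ (fmax_mem (hne V hV))).2.trans_le (le_fmax hy)⟩
  · rintro ⟨W, hW, h1, h2⟩
    exact ⟨W, hW, fmin W, fmin_mem (hne W hW), fmax W, fmax_mem (hne W hW), fun v hv =>
      ⟨h1.trans_le (fmin_le hv), (le_fmax hv).trans_lt h2⟩⟩

/-- For every `n ≥ 1` and every sequence `(t_k)` in a commutative ring,
`Σ_{π ∈ NCL(n)} ∏_{A block of π} t_{|A|-1}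
  = Σ_{α ∈ NC(n)}
      (∏_{U outer block of α} t_{|U|-1}) · (∏_{V inner block of α} (t_{|V|-1} + t_{|V|}))`. -/
theorem stmt19 {R : Type*} [CommRing R] (t : ℕ → R) (n : ℕ) (hn : 1 ≤ n) :
    ∑ π ∈ NCLF n, ∏ A ∈ π, t (A.card - 1)
      = ∑ α ∈ NCF n,
          (∏ U ∈ α.filter fun U => OuterBlock α U, t (U.card - 1))
            * ∏ V ∈ α.filter fun V => ¬ OuterBlock α V, (t (V.card - 1) + t V.card) := by
  have hL : ∑ π ∈ NCLF n, ∏ A ∈ π, t (A.card - 1) = sumL t (Finset.Icc 1 n) := by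
    rw [NCLF_eq]
    rfl
  rw [hL, sumL_eq_sumM, NCF_eq]
  refine Finset.sum_congr rfl fun α hα => ?_
  rw [mem_NCfam] at hα
  rw [← Finset.prod_filter_mul_prod_filter_not α (fun U => OuterBlock α U)]
  congr 1
  · refine Finset.prod_congr rfl fun V hV => ?_
    rw [Finset.mem_filter] at hV
    rw [wtM, if_neg]
    rw [outer_iff hα.ne hV.1, not_not]
    exact hV.2
  · refine Finset.prod_congr rfl fun V hV => ?_
    rw [Finset.mem_filter] at hV
    rw [wtM, if_pos ((outer_iff hα.ne hV.1).mpr hV.2)]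
    have h1 : 0 < V.card := Finset.card_pos.mpr (hα.ne V hV.1)
    rw [Nat.sub_add_cancel h1]
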